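/- arXiv:2310.20047 — 2 statements merged into one kernel-verified Lean document; each statement's English description precedes it below -/
import Mathlib

section
/- Let G be a Borel graph on a Polish space V(G) such that there exist d ∈ ℕ and δ > 0 for which every connected component of G is an infinite, vertex-transitive graph with all degrees at most d that is non-amenable with expansion constant δ (i.e., every finite set F of vertices of the component satisfies |E(F, F^c)| ≥ δ|F|). Then there exists a Borel G-invariant comeager set S ⊆ V(G) and a Borel set M of edges of G such that M is a perfect matching of the induced subgraph of G on S (every vertex of S is incident to exactly one edge of M, and every edge of M has both endpoints in S). -/
open Set

/-- The set of edges of `G` with one endpoint in `A` and the other in `B`. -/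
def edgesBetween {V : Type*} (G : SimpleGraph V) (A B : Set V) : Set (Sym2 V) :=
  {e | e ∈ G.edgeSet ∧ ∃ a ∈ A, ∃ b ∈ B, e = s(a, b)}

/-- `S` is a union of connected components of `G`. -/
def Invariant {V : Type*} (G : SimpleGraph V) (S : Set V) : Prop :=
  ∀ ⦃x⦄, x ∈ S → ∀ ⦃y⦄, G.Reachable x y → y ∈ S

/-- `M` (a symmetric set of ordered pairs) is a perfect matching of the induced
subgraph of `G` on `S`: every pair in `M` is an edge of `G` with both endpoints in `S`,
and every vertex of `S` has exactly one `M`-partner. -/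
def IsPerfectMatchingOn {V : Type*} (G : SimpleGraph V) (S : Set V) (M : Set (V × V)) : Prop :=
  (∀ p ∈ M, G.Adj p.1 p.2) ∧
  (∀ x y : V, (x, y) ∈ M → (y, x) ∈ M) ∧
  (∀ p ∈ M, p.1 ∈ S ∧ p.2 ∈ S) ∧
  (∀ x ∈ S, ∃! y : V, (x, y) ∈ M)

open scoped Classical in
/-- A Borel relation on a standard Borel space whose sections have at most `d` points is covered by
the graphs of countably many Borel functions. -/
lemma exists_measurable_enum {V : Type*} [MeasurableSpace V] [StandardBorelSpace V]
    {E : Set (V × V)} (hE : MeasurableSet E) (d : ℕ)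
    (hfin : ∀ x, {y | (x, y) ∈ E}.Finite) (hcard : ∀ x, {y | (x, y) ∈ E}.ncard ≤ d) :
    ∃ g : ℕ → V → V, (∀ n, Measurable (g n)) ∧ (∀ n x, g n x = x ∨ (x, g n x) ∈ E) ∧
      ∀ x y, (x, y) ∈ E → ∃ n, g n x = y := by
  let f := MeasureTheory.embeddingReal V
  have hf : MeasurableEmbedding f := MeasureTheory.measurableEmbedding_embeddingReal V
  let T : ∀ k : ℕ, Set (V × (Fin k → V)) := fun k =>
    {p | (∀ i j, i < j → f (p.2 i) < f (p.2 j)) ∧ ∀ i, (p.1, p.2 i) ∈ E}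
  have hT : ∀ k, MeasurableSet (T k) := by
    intro k
    have h1 : ∀ i : Fin k, Measurable fun p : V × (Fin k → V) => p.2 i := fun i => by fun_prop
    refine MeasurableSet.inter (s₁ := {p : V × (Fin k → V) | ∀ i j, i < j → f (p.2 i) < f (p.2 j)})
      (s₂ := {p : V × (Fin k → V) | ∀ i, (p.1, p.2 i) ∈ E}) ?_ ?_
    · simp only [ofPred_forall]
      refine .iInter fun i => .iInter fun j => .iInter fun _ => ?_
      exact measurableSet_lt (hf.measurable.comp (h1 i)) (hf.measurable.comp (h1 j))
    · simp only [ofPred_forall]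
      exact .iInter fun i => (measurable_fst.prodMk (h1 i)) hE
  have mono : ∀ {k} {p : V × (Fin k → V)}, p ∈ T k → StrictMono (f ∘ p.2) :=
    fun hp i j hij => hp.1 i j hij
  have inj : ∀ {k} {p : V × (Fin k → V)}, p ∈ T k → Function.Injective p.2 :=
    fun hp => (mono hp).injective.of_comp
  have sub : ∀ {k} {p : V × (Fin k → V)}, p ∈ T k → range p.2 ⊆ {y | (p.1, y) ∈ E} := by
    rintro k p hp _ ⟨i, rfl⟩
    exact hp.2 i
  have ncr : ∀ {k} {p : V × (Fin k → V)}, p ∈ T k → (range p.2).ncard = k := by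
    intro k p hp
    rw [← image_univ, ncard_image_of_injective _ (inj hp), ncard_univ, Nat.card_fin]
  have rng : ∀ {k} {p : V × (Fin k → V)}, p ∈ T k → {y | (p.1, y) ∈ E}.ncard = k →
      range p.2 = {y | (p.1, y) ∈ E} := by
    intro k p hp hk
    exact eq_of_subset_of_ncard_le (sub hp) (by rw [ncr hp, hk]) (hfin _)
  have le : ∀ {k} {p : V × (Fin k → V)}, p ∈ T k → k ≤ {y | (p.1, y) ∈ E}.ncard := by
    intro k p hp
    exact (ncr hp).symm.trans_le (ncard_le_ncard (sub hp) (hfin _))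
  have ex : ∀ x, ∃ t, (x, t) ∈ T {y | (x, y) ∈ E}.ncard := by
    intro x
    let s : Finset ℝ := ((hfin x).image f).toFinset
    have hs : s.card = {y | (x, y) ∈ E}.ncard := by
      rw [← ncard_eq_toFinset_card _ ((hfin x).image f), ncard_image_of_injective _ hf.injective]
    have : ∀ i, ∃ y, (x, y) ∈ E ∧ f y = s.orderEmbOfFin hs i := by
      intro i
      have := s.orderEmbOfFin_mem hs i
      exact (Set.Finite.mem_toFinset ((hfin x).image f)).1 this
    choose t ht1 ht2 using this
    refine ⟨t, fun i j hij => ?_, ht1⟩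
    simp only [ht2]
    exact (s.orderEmbOfFin hs).strictMono hij
  let D : ℕ → Set V := fun k => {x | {y | (x, y) ∈ E}.ncard = k}
  let R : ∀ k : ℕ, Set (V × (Fin k → V)) := fun k => {p | p ∈ T k ∧ p.1 ∈ D k}
  have hRinj : ∀ k, InjOn Prod.fst (R k) := by
    intro k p hp q hq hpq
    refine Prod.ext hpq ?_
    have h1 := rng hp.1 hp.2
    have h2 := rng hq.1 hq.2
    have : f ∘ p.2 = f ∘ q.2 := by
      rw [← (mono hp.1).range_inj (mono hq.1), range_comp, range_comp, h1, h2, hpq]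
    funext i
    exact hf.injective (congrFun this i)
  have hR' : ∀ k, (∀ j, k < j → MeasurableSet (D j)) → MeasurableSet (R k) := by
    intro k hk
    have : R k = T k \ ⋃ j, ⋃ _ : k < j, Prod.fst ⁻¹' D j := by
      ext p
      simp only [R, D, mem_ofPred_eq, mem_sdiff, mem_iUnion, mem_preimage, exists_prop, not_exists,
        not_and]
      constructor
      · rintro ⟨h1, h2⟩
        exact ⟨h1, fun j hj h => by omega⟩
      · rintro ⟨h1, h2⟩
        refine ⟨h1, ?_⟩
        by_contra h
        exact h2 _ (lt_of_le_of_ne (le h1) (Ne.symm h)) rfl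
    rw [this]
    exact (hT k).diff (.iUnion fun j => .iUnion fun hj => measurable_fst (hk j hj))
  have hDR : ∀ k, D k = Prod.fst '' R k := by
    intro k
    ext x
    constructor
    · rintro rfl
      obtain ⟨t, ht⟩ := ex x
      exact ⟨(x, t), ⟨ht, rfl⟩, rfl⟩
    · rintro ⟨p, hp, rfl⟩
      exact hp.2
  have hD : ∀ n k, d < k + n → MeasurableSet (D k) := by
    intro n
    induction n with
    | zero =>
      intro k hk
      have : D k = ∅ := by
        ext x
        have := hcard x
        simp only [D, mem_ofPred_eq, mem_empty_iff_false, iff_false]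
        omega
      rw [this]
      exact .empty
    | succ n ih =>
      intro k hk
      rw [hDR]
      exact (hR' k fun j hj => ih j (by omega)).image_of_measurable_injOn measurable_fst (hRinj k)
  have hD' : ∀ k, MeasurableSet (D k) := fun k => hD (d + 1) k (by omega)
  have hR : ∀ k, MeasurableSet (R k) := fun k => hR' k fun j _ => hD' j
  have ex' : ∀ k x, ∃ t : Fin k → V, x ∈ D k → (x, t) ∈ R k := by
    intro k x
    by_cases h : x ∈ D k
    · obtain ⟨p, hp, rfl⟩ := (hDR k) ▸ h
      exact ⟨p.2, fun _ => hp⟩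
    · exact ⟨fun _ => x, fun h' => absurd h' h⟩
  choose t ht using ex'
  let g : (Σ k, Fin k) → V → V := fun i x => if x ∈ D i.1 then t i.1 x i.2 else x
  have hg : ∀ i, Measurable (g i) := by
    rintro ⟨k, i⟩ B hB
    have : g ⟨k, i⟩ ⁻¹' B = (Prod.fst '' (R k ∩ {p | p.2 i ∈ B})) ∪ ((D k)ᶜ ∩ B) := by
      ext x
      by_cases hx : x ∈ D k
      · simp only [g, mem_preimage, hx, if_true, mem_union, mem_inter_iff, mem_compl_iff,
          not_true_eq_false, false_and, or_false, mem_image]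
        constructor
        · intro h
          exact ⟨(x, t k x), ⟨ht k x hx, h⟩, rfl⟩
        · rintro ⟨p, ⟨hp, hpB⟩, rfl⟩
          have := hRinj k hp (ht k p.1 hx) rfl
          rw [this] at hpB
          exact hpB
      · have : ∀ p ∈ R k, p.1 ≠ x := by
          rintro p hp rfl
          exact hx hp.2
        simp only [g, mem_preimage, hx, if_false, mem_union, mem_inter_iff, mem_compl_iff,
          not_false_eq_true, true_and, mem_image]
        constructor
        · exact Or.inr
        · rintro (⟨p, hp, h⟩ | h)
          · exact absurd h (this p hp.1)
          · exact h
    rw [this]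
    refine .union ?_ ((hD' k).compl.inter hB)
    refine ((hR k).inter ?_).image_of_measurable_injOn measurable_fst
      ((hRinj k).mono inter_subset_left)
    exact (by fun_prop : Measurable fun p : V × (Fin k → V) => p.2 i) hB
  have : Nonempty (Σ k, Fin k) := ⟨⟨1, 0⟩⟩
  obtain ⟨e, he⟩ := exists_surjective_nat (Σ k, Fin k)
  refine ⟨fun n => g (e n), fun n => hg _, fun n x => ?_, fun x y hxy => ?_⟩
  · by_cases hx : x ∈ D (e n).1
    · right
      simp only [g, hx, if_true]
      exact (ht _ x hx).1.2 _
    · left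
      simp [g, hx]
  · have hx : x ∈ D {y | (x, y) ∈ E}.ncard := rfl
    have h1 := ht _ x hx
    obtain ⟨i, rfl⟩ := (rng h1.1 hx).ge hxy
    obtain ⟨n, hn⟩ := he ⟨_, i⟩
    exact ⟨n, by simp only [g, hn]; rw [if_pos hx]⟩

/-- The edges of `G` leaving the finite set `F`, oriented outwards. -/
def outEdges {V : Type*} (G : SimpleGraph V) (F : Finset V) : Set (V × V) :=
  {p | p.1 ∈ F ∧ p.2 ∉ F ∧ G.Adj p.1 p.2}

lemma finite_outEdges {V : Type*} {G : SimpleGraph V} (hLF : ∀ v, (G.neighborSet v).Finite)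
    (F : Finset V) : (outEdges G F).Finite := by
  refine (F.finite_toSet.biUnion fun v _ => (hLF v).image (Prod.mk v)).subset ?_
  rintro ⟨a, b⟩ ⟨ha, -, hab⟩
  exact mem_biUnion (x := a) ha ⟨b, hab, rfl⟩

lemma ncard_outEdges {V : Type*} {G : SimpleGraph V} (hLF : ∀ v, (G.neighborSet v).Finite)
    (F : Finset V) : (outEdges G F).ncard = ∑ v ∈ F, (G.neighborSet v \ F).ncard := by
  classical
  rw [ncard_eq_toFinset_card _ (finite_outEdges hLF F),
    Finset.card_eq_sum_card_fiberwise (f := Prod.fst) (t := F)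
      (fun p hp => ((Finite.mem_toFinset _).1 hp).1)]
  refine Finset.sum_congr rfl fun v hv => ?_
  rw [← ncard_image_of_injective _ (Prod.mk_right_injective v), ← ncard_coe_finset]
  congr 1
  ext ⟨a, b⟩
  simp only [outEdges, Finset.coe_filter, Finite.mem_toFinset, mem_ofPred_eq, mem_image, mem_sdiff,
    SimpleGraph.mem_neighborSet, Finset.mem_coe, Prod.mk.injEq]
  constructor
  · rintro ⟨⟨h1, h2, h3⟩, rfl⟩
    exact ⟨b, ⟨h3, h2⟩, rfl, rfl⟩
  · rintro ⟨c, ⟨h3, h2⟩, rfl, rfl⟩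
    exact ⟨⟨hv, h2, h3⟩, rfl⟩

lemma ncard_outEdges_inter_add_union {V : Type*} [DecidableEq V] {G : SimpleGraph V}
    (hLF : ∀ v, (G.neighborSet v).Finite) (A B : Finset V) :
    (outEdges G (A ∩ B)).ncard + (outEdges G (A ∪ B)).ncard ≤
      (outEdges G A).ncard + (outEdges G B).ncard := by
  have hf := finite_outEdges hLF
  rw [← ncard_union_add_ncard_inter _ _ (hf _) (hf _),
    ← ncard_union_add_ncard_inter (outEdges G A) _ (hf _) (hf _)]
  refine add_le_add (ncard_le_ncard ?_ ((hf A).union (hf B)))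
    (ncard_le_ncard ?_ ((hf A).inter_of_left _))
  · rintro ⟨a, b⟩ h
    simp only [outEdges, mem_union, mem_ofPred_eq, Finset.mem_inter, Finset.mem_union] at *
    tauto
  · rintro ⟨a, b⟩ h
    simp only [outEdges, mem_inter_iff, mem_ofPred_eq, Finset.mem_inter, Finset.mem_union] at *
    tauto

/-- A vertex-transitive graph all of whose finite sets have nonempty boundary is maximally
edge-connected. -/
lemma ncard_neighborSet_le_ncard_outEdges {V : Type*} {G : SimpleGraph V}
    (hLF : ∀ v, (G.neighborSet v).Finite) (htr : ∀ u v, ∃ φ : G ≃g G, φ u = v)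
    (hpos : ∀ F : Finset V, F.Nonempty → 0 < (outEdges G F).ncard)
    {F : Finset V} (hF : F.Nonempty) (v : V) :
    (G.neighborSet v).ncard ≤ (outEdges G F).ncard := by
  classical
  have hmap : ∀ (φ : G ≃g G) (A : Finset V),
      (outEdges G (A.image φ)).ncard = (outEdges G A).ncard := by
    intro φ A
    rw [← ncard_image_of_injective (outEdges G A) (φ.injective.prodMap φ.injective)]
    congr 1
    ext ⟨a, b⟩
    obtain ⟨a, rfl⟩ := φ.surjective a
    obtain ⟨b, rfl⟩ := φ.surjective b
    have : (φ a, φ b) = Prod.map φ φ (a, b) := rfl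
    rw [this, (φ.injective.prodMap φ.injective).mem_set_image]
    simp only [outEdges, mem_ofPred_eq, Prod.map_fst, Prod.map_snd,
      φ.injective.mem_finset_image, SimpleGraph.Iso.map_adj_iff]
  let P : Finset V → Prop := fun A =>
    A.Nonempty ∧ ∀ B : Finset V, B.Nonempty → (outEdges G A).ncard ≤ (outEdges G B).ncard
  have hP : ∃ A, P A := by
    obtain ⟨A, hA, hA'⟩ := exists_minimalFor_of_wellFoundedLT (fun A : Finset V => A.Nonempty)
      (fun A => (outEdges G A).ncard) ⟨F, hF⟩
    refine ⟨A, hA, fun B hB => ?_⟩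
    rcases le_total (outEdges G A).ncard (outEdges G B).ncard with h | h
    · exact h
    · exact hA' hB h
  obtain ⟨A, ⟨hA, hAmin⟩, hA'⟩ := exists_minimalFor_of_wellFoundedLT P Finset.card hP
  have key : ∀ (φ : G ≃g G) (u : V), u ∈ A → φ u ∈ A → A.image φ = A := by
    intro φ u hu hφ
    set B := A.image φ with hB
    have h1 : (A ∩ B).Nonempty := ⟨φ u, Finset.mem_inter.2 ⟨hφ, Finset.mem_image_of_mem _ hu⟩⟩
    have h2 := ncard_outEdges_inter_add_union hLF A B
    have h3 := hAmin _ (hA.mono (Finset.subset_union_left (s₂ := B)))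
    have h4 : P (A ∩ B) := by
      refine ⟨h1, fun C hC => ?_⟩
      have := hAmin C hC
      rw [hmap] at h2
      omega
    have h5 : A.card ≤ (A ∩ B).card := by
      rcases le_total A.card (A ∩ B).card with h | h
      · exact h
      · exact hA' h4 h
    have h6 := Finset.eq_of_subset_of_card_le Finset.inter_subset_left h5
    exact (Finset.eq_of_subset_of_card_le (Finset.inter_eq_left.1 h6)
      (Finset.card_image_of_injective _ φ.injective).le).symm
  have hdeg : ∀ u w, (G.neighborSet u).ncard = (G.neighborSet w).ncard := by
    intro u w
    obtain ⟨φ, rfl⟩ := htr u w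
    rw [← ncard_image_of_injective _ φ.injective]
    congr 1
    ext y
    obtain ⟨y, rfl⟩ := φ.surjective y
    rw [φ.injective.mem_set_image]
    simp only [SimpleGraph.mem_neighborSet, SimpleGraph.Iso.map_adj_iff]
  obtain ⟨u, hu⟩ := hA
  have hin : ∀ w ∈ A, (G.neighborSet w \ A).ncard = (G.neighborSet u \ A).ncard := by
    intro w hw
    obtain ⟨φ, rfl⟩ := htr u w
    rw [← ncard_image_of_injective (G.neighborSet u \ A) φ.injective]
    congr 1
    ext y
    obtain ⟨y, rfl⟩ := φ.surjective y
    rw [φ.injective.mem_set_image]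
    have : φ y ∈ A ↔ y ∈ A := by
      conv_lhs => rw [← key φ u hu hw]
      exact φ.injective.mem_finset_image
    simp only [mem_sdiff, SimpleGraph.mem_neighborSet, SimpleGraph.Iso.map_adj_iff, Finset.mem_coe,
      this]
  have hcount : (outEdges G A).ncard = A.card * (G.neighborSet u \ A).ncard := by
    rw [ncard_outEdges hLF, Finset.sum_congr rfl hin, Finset.sum_const, smul_eq_mul]
  have hs : 0 < (G.neighborSet u \ A).ncard := by
    have := hpos A ⟨u, hu⟩
    rw [hcount] at this
    exact Nat.pos_of_mul_pos_left this
  have ht : (G.neighborSet u ∩ A).ncard < A.card := by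
    rw [← ncard_coe_finset]
    refine ncard_lt_ncard ⟨inter_subset_right, fun h => ?_⟩ A.finite_toSet
    exact G.loopless.irrefl u (h hu).1
  have hsum := ncard_inter_add_ncard_sdiff_eq_ncard (G.neighborSet u) (A : Set V) (hLF u)
  have hmin := hAmin F hF
  rw [hcount] at hmin
  rw [hdeg v u]
  refine le_trans ?_ hmin
  nlinarith

/-- `F` is connected in `G`: no nonempty proper subset of `F` is cut off from the rest of `F`. -/
def IsLinked {V : Type*} (G : SimpleGraph V) (F : Finset V) : Prop :=
  ∀ K ⊆ F, K.Nonempty → K ≠ F → ∃ a ∈ K, ∃ b ∈ F, b ∉ K ∧ G.Adj a b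

/-- `𝒞` is a family of pairwise disjoint odd finite sets, each of which is separated by `X` from the
rest of the induced subgraph of `G` on `U`. -/
structure IsBarrier {V : Type*} (G : SimpleGraph V) (U : Set V) (X : Finset V)
    (𝒞 : Finset (Finset V)) : Prop where
  subset : ↑X ⊆ U
  subset_of_mem : ∀ C ∈ 𝒞, ↑C ⊆ U
  disjoint : ∀ C ∈ 𝒞, ∀ C' ∈ 𝒞, C ≠ C' → Disjoint C C'
  disjoint_left : ∀ C ∈ 𝒞, Disjoint C X
  odd : ∀ C ∈ 𝒞, Odd C.card
  closed : ∀ C ∈ 𝒞, ∀ a ∈ C, ∀ b ∈ U, G.Adj a b → b ∈ C ∨ b ∈ X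

open scoped Classical in
/-- The set of all vertices occurring in the barrier `(X, 𝒞)`. -/
noncomputable def barrierSupport {V : Type*} (X : Finset V) (𝒞 : Finset (Finset V)) : Finset V :=
  X ∪ 𝒞.biUnion id

/-- Tutte's condition for the induced subgraph of `G` on `U`, with a linear margin for
large connected barriers. -/
def IsRobust {V : Type*} (G : SimpleGraph V) (U : Set V) : Prop :=
  ∃ ε : ℝ, 0 < ε ∧ ∃ m : ℕ, ∀ X 𝒞, IsBarrier G U X 𝒞 → (∀ C ∈ 𝒞, IsLinked G C) →
    IsLinked G (barrierSupport X 𝒞) → 𝒞.card ≤ X.card ∧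
      (m ≤ (barrierSupport X 𝒞).card → 𝒞.card + ε * (barrierSupport X 𝒞).card ≤ X.card)

lemma mem_barrierSupport {V : Type*} {X : Finset V} {𝒞 : Finset (Finset V)} {v : V} :
    v ∈ barrierSupport X 𝒞 ↔ v ∈ X ∨ ∃ C ∈ 𝒞, v ∈ C := by
  simp [barrierSupport]

lemma IsLinked.reachable {V : Type*} {G : SimpleGraph V} {F : Finset V} (hF : IsLinked G F)
    {x y : V} (hx : x ∈ F) (hy : y ∈ F) : G.Reachable x y := by
  classical
  by_contra hxy
  obtain ⟨a, ha, b, hb, hbK, hab⟩ := hF (F.filter (G.Reachable x)) (Finset.filter_subset _ _)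
    ⟨x, by simp [hx]⟩ (fun h => hxy (Finset.mem_filter.1 (h.ge hy)).2)
  exact hbK (Finset.mem_filter.2 ⟨hb, (Finset.mem_filter.1 ha).2.trans hab.reachable⟩)

lemma ncard_edgesBetween_le {V : Type*} {G : SimpleGraph V} (hLF : ∀ v, (G.neighborSet v).Finite)
    (K : Set V) (F : Finset V) :
    (edgesBetween G F (K \ F)).ncard ≤ (outEdges G F).ncard := by
  have hf := finite_outEdges hLF F
  refine (ncard_le_ncard ?_ (hf.image (fun p => s(p.1, p.2)))).trans (ncard_image_le hf)
  rintro e ⟨he, a, ha, b, hb, rfl⟩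
  exact ⟨(a, b), ⟨ha, hb.2, he⟩, rfl⟩

lemma ncard_neighborSet_le_of_induce {V : Type*} {G : SimpleGraph V}
    (hLF : ∀ v, (G.neighborSet v).Finite) {x : V}
    (htrans : ∀ u v : {y : V | G.Reachable x y},
      ∃ φ : G.induce {y : V | G.Reachable x y} ≃g G.induce {y : V | G.Reachable x y}, φ u = v)
    (hpos : ∀ F : Finset V, ↑F ⊆ {y : V | G.Reachable x y} → F.Nonempty →
      0 < (outEdges G F).ncard)
    {F : Finset V} (hFx : ↑F ⊆ {y : V | G.Reachable x y}) (hF : F.Nonempty) :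
    (G.neighborSet x).ncard ≤ (outEdges G F).ncard := by
  classical
  set K := {y : V | G.Reachable x y} with hK
  have hnb : ∀ v : K, (G.induce K).neighborSet v = Subtype.val ⁻¹' G.neighborSet v := by
    intro v
    ext w
    simp
  have hout : ∀ B : Finset K,
      (outEdges G (B.map (Function.Embedding.subtype _))).ncard =
        (outEdges (G.induce K) B).ncard := by
    intro B
    rw [← ncard_image_of_injective (outEdges (G.induce K) B)
      (Subtype.val_injective.prodMap Subtype.val_injective)]
    congr 1
    ext ⟨a, b⟩
    constructor
    · rintro ⟨ha, hb, hab⟩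
      obtain ⟨a, ha', rfl⟩ := Finset.mem_map.1 ha
      have hbK : b ∈ K := a.2.trans (SimpleGraph.Adj.reachable hab)
      exact ⟨(a, ⟨b, hbK⟩), ⟨ha', fun h => hb (Finset.mem_map.2 ⟨_, h, rfl⟩), hab⟩, rfl⟩
    · rintro ⟨⟨a', b'⟩, ⟨ha, hb, hab⟩, h⟩
      obtain ⟨rfl, rfl⟩ := Prod.mk.inj h
      refine ⟨Finset.mem_map.2 ⟨_, ha, rfl⟩, fun h => hb ?_, hab⟩
      obtain ⟨b'', h1, h2⟩ := Finset.mem_map.1 h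
      exact Subtype.ext h2 ▸ h1
  have hFK : (F.subtype (· ∈ K)).map (Function.Embedding.subtype _) = F :=
    Finset.subtype_map_of_mem fun y hy => hFx hy
  have := ncard_neighborSet_le_ncard_outEdges (G := G.induce K)
    (fun v => by
      rw [hnb]
      exact (hLF v).preimage Subtype.val_injective.injOn) htrans
    (fun B hB => by
      rw [← hout]
      refine hpos _ (fun y hy => ?_) (hB.map)
      obtain ⟨y, -, rfl⟩ := Finset.mem_map.1 hy
      exact y.2)
    (F := F.subtype (· ∈ K)) (by rw [← Finset.map_nonempty, hFK]; exact hF)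
    ⟨x, SimpleGraph.Reachable.refl x⟩
  rw [← hout, hFK, hnb] at this
  rwa [← ncard_preimage_of_injective_subset_range (s := G.neighborSet x) Subtype.val_injective]
  intro y hy
  exact ⟨⟨y, SimpleGraph.Adj.reachable hy⟩, rfl⟩

lemma IsBarrier.sum_ncard_outEdges_le {V : Type*} {G : SimpleGraph V}
    (hLF : ∀ v, (G.neighborSet v).Finite) {X : Finset V} {𝒞 : Finset (Finset V)}
    (h : IsBarrier G univ X 𝒞) :
    ∑ C ∈ 𝒞, (outEdges G C).ncard + (outEdges G (barrierSupport X 𝒞)).ncard ≤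
      ∑ v ∈ X, (G.neighborSet v).ncard := by
  classical
  let N : V → Finset V := fun v => (hLF v).toFinset
  have hN : ∀ {v w}, w ∈ N v ↔ G.Adj v w := fun {v w} => by simp [N]
  let O : Finset V → Finset (V × V) := fun C => (finite_outEdges hLF C).toFinset
  have hO : ∀ {C p}, p ∈ O C ↔ p.1 ∈ C ∧ p.2 ∉ C ∧ G.Adj p.1 p.2 := fun {C p} => by
    simp [O, outEdges]
  have hOc : ∀ C, (outEdges G C).ncard = ((O C).image Prod.swap).card := fun C => by
    rw [Finset.card_image_of_injective _ Prod.swap_injective,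
      ncard_eq_toFinset_card _ (finite_outEdges hLF C)]
  rw [Finset.sum_congr rfl fun C _ => hOc C, ← Finset.card_biUnion,
    Finset.sum_congr rfl fun v _ => ncard_eq_toFinset_card (G.neighborSet v) (hLF v),
    ← Finset.card_sigma, ncard_eq_toFinset_card _ (finite_outEdges hLF _),
    ← Finset.card_union_of_disjoint]
  · refine Finset.card_le_card_of_injOn (fun p => ⟨p.1, p.2⟩) ?_ ?_
    · rintro ⟨a, b⟩ hab
      simp only [Finset.coe_union, mem_union, Finset.mem_coe, Finset.mem_biUnion,
        Finset.mem_image] at hab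
      rw [Finset.mem_coe, Finset.mem_sigma]
      rcases hab with ⟨C, hC, ⟨b', a'⟩, hp, hpe⟩ | hab
      · obtain ⟨rfl, rfl⟩ := Prod.mk.inj hpe
        obtain ⟨h1, h2, h3⟩ := hO.1 hp
        exact ⟨(h.closed C hC _ h1 _ (mem_univ _) h3).resolve_left h2, hN.2 h3.symm⟩
      · obtain ⟨h1, h2, h3⟩ := hO.1 hab
        refine ⟨?_, hN.2 h3⟩
        rw [mem_barrierSupport] at h1 h2
        push Not at h2
        rcases h1 with h1 | ⟨C, hC, h1⟩
        · exact h1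
        · exact absurd (h.closed C hC _ h1 _ (mem_univ _) h3) (not_or.2 ⟨h2.2 C hC, h2.1⟩)
    · rintro ⟨a, b⟩ - ⟨a', b'⟩ - hab
      simpa using hab
  · rw [Finset.disjoint_left]
    rintro ⟨a, b⟩ h1 h2
    obtain ⟨C, hC, h1⟩ := Finset.mem_biUnion.1 h1
    obtain ⟨⟨b', a'⟩, hp, hpe⟩ := Finset.mem_image.1 h1
    obtain ⟨rfl, rfl⟩ := Prod.mk.inj hpe
    exact (hO.1 h2).2.1 (mem_barrierSupport.2 (Or.inr ⟨C, hC, (hO.1 hp).1⟩))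
  · intro C hC C' hC' hne
    rw [Function.onFun, Finset.disjoint_left]
    rintro ⟨a, b⟩ h1 h2
    obtain ⟨⟨b', a'⟩, hp, hpe⟩ := Finset.mem_image.1 h1
    obtain ⟨⟨b'', a''⟩, hp', hpe'⟩ := Finset.mem_image.1 h2
    obtain ⟨rfl, rfl⟩ := Prod.mk.inj hpe
    obtain ⟨rfl, rfl⟩ := Prod.mk.inj hpe'
    exact Finset.disjoint_left.1 (h.disjoint C hC C' hC' hne) (hO.1 hp).1 (hO.1 hp').1

lemma isRobust_univ {V : Type*} (G : SimpleGraph V) (d : ℕ) (δ : ℝ) (hδ : 0 < δ)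
    (hLF : ∀ v : V, (G.neighborSet v).Finite)
    (hdeg : ∀ v : V, (G.neighborSet v).ncard ≤ d)
    (htrans : ∀ x : V, ∀ u v : {y : V | G.Reachable x y},
      ∃ φ : G.induce {y : V | G.Reachable x y} ≃g G.induce {y : V | G.Reachable x y}, φ u = v)
    (hexp : ∀ x : V, ∀ F : Set V, F ⊆ {y : V | G.Reachable x y} → F.Finite →
      δ * F.ncard ≤ ((edgesBetween G F ({y : V | G.Reachable x y} \ F)).ncard : ℝ)) :
    IsRobust G univ := by
  have hexp' : ∀ (x : V) (F : Finset V), ↑F ⊆ {y : V | G.Reachable x y} →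
      δ * F.card ≤ (outEdges G F).ncard := by
    intro x F hF
    have := hexp x F hF F.finite_toSet
    rw [ncard_coe_finset] at this
    exact this.trans (by exact_mod_cast ncard_edgesBetween_le hLF _ F)
  have hconn : ∀ (x : V) (F : Finset V), ↑F ⊆ {y : V | G.Reachable x y} → F.Nonempty →
      (G.neighborSet x).ncard ≤ (outEdges G F).ncard := by
    intro x F hFx hF
    refine ncard_neighborSet_le_of_induce hLF (htrans x) (fun B hB hne => ?_) hFx hF
    have h1 := hexp' x B hB
    have h2 : (0 : ℝ) < B.card := by exact_mod_cast hne.card_pos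
    have h3 : (0 : ℝ) < (outEdges G B).ncard := (mul_pos hδ h2).trans_le h1
    exact_mod_cast h3
  refine ⟨δ / (d + 1), by positivity, 0, fun X 𝒞 hb _ hl => ?_⟩
  suffices h : 𝒞.card + δ / (d + 1) * (barrierSupport X 𝒞).card ≤ X.card by
    refine ⟨?_, fun _ => h⟩
    have : (0 : ℝ) ≤ δ / (d + 1) * (barrierSupport X 𝒞).card := by positivity
    have : (𝒞.card : ℝ) ≤ X.card := by linarith
    exact_mod_cast this
  rcases (barrierSupport X 𝒞).eq_empty_or_nonempty with he | ⟨x, hx⟩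
  · have : 𝒞 = ∅ := by
      rw [Finset.eq_empty_iff_forall_notMem]
      intro C hC
      obtain ⟨y, hy⟩ := Finset.card_pos.1 (hb.odd C hC).pos
      have : y ∈ barrierSupport X 𝒞 := mem_barrierSupport.2 (Or.inr ⟨C, hC, hy⟩)
      simp [he] at this
    rw [he, this]
    simp
  set F := barrierSupport X 𝒞 with hF
  set D := (G.neighborSet x).ncard with hD
  have hFx : ↑F ⊆ {y : V | G.Reachable x y} := fun y hy => hl.reachable hx hy
  have h1 := hb.sum_ncard_outEdges_le hLF
  have h2 : 𝒞.card * D ≤ ∑ C ∈ 𝒞, (outEdges G C).ncard := by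
    rw [← smul_eq_mul]
    refine Finset.card_nsmul_le_sum _ _ _ fun C hC => ?_
    refine hconn x C (fun y hy => hFx ?_) (Finset.card_pos.1 (hb.odd C hC).pos)
    exact mem_barrierSupport.2 (Or.inr ⟨C, hC, hy⟩)
  have h3 : ∑ v ∈ X, (G.neighborSet v).ncard ≤ X.card * D := by
    rw [← smul_eq_mul]
    refine Finset.sum_le_card_nsmul _ _ _ fun v hv => ?_
    have hvx : G.Reachable x v := hFx (mem_barrierSupport.2 (Or.inl hv))
    refine (hconn v {x} (by simpa using hvx.symm) (Finset.singleton_nonempty x)).trans ?_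
    rw [ncard_outEdges hLF, Finset.sum_singleton]
    exact ncard_le_ncard sdiff_subset (hLF x)
  have h4 := hexp' x F hFx
  have h5 : (𝒞.card : ℝ) * D + (outEdges G F).ncard ≤ X.card * D := by
    exact_mod_cast (Nat.add_le_add_right h2 _).trans (h1.trans h3)
  have h6 : (1 : ℝ) ≤ F.card := by exact_mod_cast Finset.card_pos.2 ⟨x, hx⟩
  have h7 : (D : ℝ) ≤ d := by exact_mod_cast hdeg x
  have h8 : (0 : ℝ) < D := by
    rcases Nat.eq_zero_or_pos D with h | h
    · rw [h] at h5
      have := mul_pos hδ (zero_lt_one.trans_le h6)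
      simp only [Nat.cast_zero, mul_zero, zero_add] at h5
      linarith
    · exact_mod_cast h
  have h9 : D * (δ / (d + 1)) ≤ δ := by
    rw [mul_div_assoc', div_le_iff₀ (by positivity)]
    nlinarith
  refine le_of_mul_le_mul_left ?_ h8
  have : (D : ℝ) * (δ / (d + 1)) * F.card ≤ δ * F.card := by gcongr
  linarith

lemma IsBarrier.card_le_of_linked {V : Type*} {G : SimpleGraph V} {U : Set V}
    (hU : ∀ X 𝒞, IsBarrier G U X 𝒞 → (∀ C ∈ 𝒞, IsLinked G C) →
      IsLinked G (barrierSupport X 𝒞) → 𝒞.card ≤ X.card)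
    {X : Finset V} {𝒞 : Finset (Finset V)} (h : IsBarrier G U X 𝒞)
    (hl : ∀ C ∈ 𝒞, IsLinked G C) : 𝒞.card ≤ X.card := by
  classical
  induction hn : (barrierSupport X 𝒞).card using Nat.strong_induction_on generalizing X 𝒞 with
  | _ n ih =>
  by_cases hF : IsLinked G (barrierSupport X 𝒞)
  · exact hU X 𝒞 h hl hF
  unfold IsLinked at hF
  push Not at hF
  obtain ⟨K, hKF, ⟨k, hk⟩, hne, hK⟩ := hF
  have hXF : ∀ v ∈ X, v ∈ barrierSupport X 𝒞 := fun v hv => mem_barrierSupport.2 (.inl hv)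
  have hCF : ∀ C ∈ 𝒞, ∀ v ∈ C, v ∈ barrierSupport X 𝒞 :=
    fun C hC v hv => mem_barrierSupport.2 (.inr ⟨C, hC, hv⟩)
  have hdis : ∀ C ∈ 𝒞, ¬ C ⊆ K → ∀ v ∈ C, v ∉ K := by
    intro C hC hCK v hvC hvK
    obtain ⟨a, ha, b, hb, hbK, hab⟩ := hl C hC (C ∩ K) Finset.inter_subset_left
      ⟨v, Finset.mem_inter.2 ⟨hvC, hvK⟩⟩ (fun h => hCK (Finset.inter_eq_left.1 h))
    refine hK a (Finset.mem_inter.1 ha).2 b (hCF C hC b hb) (fun h => hbK ?_) hab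
    exact Finset.mem_inter.2 ⟨hb, h⟩
  have h1 : IsBarrier G U (X ∩ K) (𝒞.filter (· ⊆ K)) := by
    refine ⟨fun v hv => h.subset (Finset.mem_inter.1 hv).1,
      fun C hC => h.subset_of_mem C (Finset.mem_filter.1 hC).1,
      fun C hC C' hC' => h.disjoint C (Finset.mem_filter.1 hC).1 C' (Finset.mem_filter.1 hC').1,
      fun C hC => (h.disjoint_left C (Finset.mem_filter.1 hC).1).mono_right
        Finset.inter_subset_left, fun C hC => h.odd C (Finset.mem_filter.1 hC).1,
      fun C hC a ha b hb hab => ?_⟩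
    obtain ⟨hC, hCK⟩ := Finset.mem_filter.1 hC
    refine (h.closed C hC a ha b hb hab).imp_right fun hbX => Finset.mem_inter.2 ⟨hbX, ?_⟩
    by_contra hbK
    exact hK a (hCK ha) b (hXF b hbX) hbK hab
  have h2 : IsBarrier G U (X \ K) (𝒞.filter (¬ · ⊆ K)) := by
    refine ⟨fun v hv => h.subset (Finset.mem_sdiff.1 hv).1,
      fun C hC => h.subset_of_mem C (Finset.mem_filter.1 hC).1,
      fun C hC C' hC' => h.disjoint C (Finset.mem_filter.1 hC).1 C' (Finset.mem_filter.1 hC').1,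
      fun C hC => (h.disjoint_left C (Finset.mem_filter.1 hC).1).mono_right
        Finset.sdiff_subset, fun C hC => h.odd C (Finset.mem_filter.1 hC).1,
      fun C hC a ha b hb hab => ?_⟩
    obtain ⟨hC, hCK⟩ := Finset.mem_filter.1 hC
    refine (h.closed C hC a ha b hb hab).imp_right fun hbX => Finset.mem_sdiff.2 ⟨hbX, ?_⟩
    intro hbK
    exact hK b hbK a (hCF C hC a ha) (hdis C hC hCK a ha) hab.symm
  have hs1 : barrierSupport (X ∩ K) (𝒞.filter (· ⊆ K)) ⊆ K := by
    intro v hv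
    rcases mem_barrierSupport.1 hv with hv | ⟨C, hC, hv⟩
    · exact (Finset.mem_inter.1 hv).2
    · exact (Finset.mem_filter.1 hC).2 hv
  have hs2 : barrierSupport (X \ K) (𝒞.filter (¬ · ⊆ K)) ⊆ barrierSupport X 𝒞 \ K := by
    intro v hv
    rcases mem_barrierSupport.1 hv with hv | ⟨C, hC, hv⟩
    · obtain ⟨h1, h2⟩ := Finset.mem_sdiff.1 hv
      exact Finset.mem_sdiff.2 ⟨hXF v h1, h2⟩
    · obtain ⟨hC, hCK⟩ := Finset.mem_filter.1 hC
      exact Finset.mem_sdiff.2 ⟨hCF C hC v hv, hdis C hC hCK v hv⟩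
  have hc1 := ih _ (hn ▸ (Finset.card_le_card hs1).trans_lt
    (Finset.card_lt_card (Finset.ssubset_iff_subset_ne.2 ⟨hKF, hne⟩))) h1
    (fun C hC => hl C (Finset.mem_filter.1 hC).1) rfl
  have hc2 := ih _ (hn ▸ (Finset.card_le_card hs2).trans_lt
    (Finset.card_lt_card (Finset.sdiff_ssubset hKF ⟨k, hk⟩))) h2
    (fun C hC => hl C (Finset.mem_filter.1 hC).1) rfl
  have e1 := Finset.card_filter_add_card_filter_not (s := 𝒞) (· ⊆ K)
  have e2 := Finset.card_inter_add_card_sdiff X K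
  omega

lemma not_lt_of_parity {n o u t : ℕ} (h : n + u = t) (ht : Even t) (hp : Odd o ↔ Odd n)
    (h1 : u < o) (h2 : o ≤ u + 1) : False := by
  obtain rfl : o = u + 1 := by omega
  subst h
  grind

/-- Under Tutte's condition every finite set of vertices carries an involution that matches
each vertex whose neighbours lie in the set with a neighbour. -/
lemma exists_involution_of_tutte {V : Type*} {G : SimpleGraph V} {U : Set V}
    (hU : ∀ X 𝒞, IsBarrier G U X 𝒞 → (∀ C ∈ 𝒞, IsLinked G C) → 𝒞.card ≤ X.card)
    {T : Finset V} (hTU : ↑T ⊆ U)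
    (hT : Even T.card ∨ ∀ a ∈ T, ∀ b ∈ U, G.Adj a b → b ∈ T) :
    ∃ P : V → V, ∀ v ∈ T, P v ∈ T ∧ P v ≠ v ∧ P (P v) = v ∧
      ((∀ w ∈ U, G.Adj v w → w ∈ T) → G.Adj v (P v)) := by
  classical
  let S : V → Prop := fun v => ∃ w ∈ U, G.Adj v w ∧ w ∉ T
  let H : SimpleGraph T :=
    { Adj := fun a b => a ≠ b ∧ (G.Adj a b ∨ (S a ∧ S b))
      symm := ⟨fun a b h => ⟨h.1.symm, h.2.imp (fun h => h.symm) And.symm⟩⟩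
      loopless := ⟨fun a h => h.1 rfl⟩ }
  have hM : ∃ M : H.Subgraph, M.IsPerfectMatching := by
    rw [SimpleGraph.tutte]
    intro u hu
    unfold SimpleGraph.IsTutteViolator at hu
    set Hu := ((⊤ : H.Subgraph).deleteVerts u).coe with hHu
    have hmem : ∀ v : T, v ∈ ((⊤ : H.Subgraph).deleteVerts u).verts ↔ v ∉ u := by
      intro v
      simp
    have hadj : ∀ a b, Hu.Adj a b ↔ H.Adj a b := by
      intro a b
      have := (hmem a).1 a.2
      have := (hmem b).1 b.2
      simp [*]
    let f : ((⊤ : H.Subgraph).deleteVerts u).verts → V := fun v => (v.1 : V)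
    have hf : Function.Injective f := Subtype.val_injective.comp Subtype.val_injective
    let X : Finset V := (u.toFinite.toFinset).map (Function.Embedding.subtype _)
    have hXc : X.card = u.ncard := by
      rw [Finset.card_map, ncard_eq_toFinset_card]
    have hXm : ∀ v (hv : v ∈ T), v ∈ X ↔ (⟨v, hv⟩ : T) ∈ u := by
      intro v hv
      simp [X, hv]
    let g : Hu.ConnectedComponent → Finset V := fun c => (c.supp.toFinite.toFinset).map ⟨f, hf⟩
    have hgm : ∀ c v, f v ∈ g c ↔ Hu.connectedComponentMk v = c := by
      intro c v
      simp [g]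
    have hgm' : ∀ c, ∀ v ∈ g c, ∃ w, f w = v ∧ Hu.connectedComponentMk w = c := by
      intro c v hv
      obtain ⟨w, -, rfl⟩ := Finset.mem_map.1 hv
      exact ⟨w, rfl, (hgm c w).1 hv⟩
    have hgc : ∀ c, (g c).card = c.supp.ncard := by
      intro c
      rw [Finset.card_map, ncard_eq_toFinset_card]
    have hgd : ∀ c c', c ≠ c' → Disjoint (g c) (g c') := by
      intro c c' hcc
      rw [Finset.disjoint_left]
      intro v hv hv'
      obtain ⟨w, rfl, rfl⟩ := hgm' c v hv
      exact hcc ((hgm c' w).1 hv')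
    have hgT : ∀ c, g c ⊆ T := by
      intro c v hv
      obtain ⟨w, rfl, -⟩ := hgm' c v hv
      exact w.1.2
    have hginj : Function.Injective g := by
      intro c c' hcc
      by_contra hne
      obtain ⟨w, rfl⟩ := c.exists_rep
      have h1 : f w ∈ g (Hu.connectedComponentMk w) := (hgm _ w).2 rfl
      exact Finset.disjoint_left.1 (hgd _ _ hne) h1 (hcc ▸ h1)
    let O₁ : Set Hu.ConnectedComponent := {c | Odd c.supp.ncard ∧ ∀ v ∈ g c, ¬ S v}
    let O₂ : Set Hu.ConnectedComponent := {c | ∃ v ∈ g c, S v}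
    let 𝒞 : Finset (Finset V) := (O₁.toFinite.toFinset).map ⟨g, hginj⟩
    have h𝒞c : 𝒞.card = O₁.ncard := by
      rw [Finset.card_map, ncard_eq_toFinset_card]
    have h𝒞 : ∀ C ∈ 𝒞, ∃ c ∈ O₁, g c = C := by
      intro C hC
      obtain ⟨c, hc, rfl⟩ := Finset.mem_map.1 hC
      exact ⟨c, (Finite.mem_toFinset _).1 hc, rfl⟩
    have hbar : IsBarrier G U X 𝒞 := by
      refine ⟨?_, ?_, ?_, ?_, ?_, ?_⟩
      · intro v hv
        obtain ⟨w, -, rfl⟩ := Finset.mem_map.1 hv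
        exact hTU w.2
      · intro C hC
        obtain ⟨c, hc, rfl⟩ := h𝒞 C hC
        exact fun v hv => hTU (hgT c hv)
      · intro C hC C' hC' hne
        obtain ⟨c, hc, rfl⟩ := h𝒞 C hC
        obtain ⟨c', hc', rfl⟩ := h𝒞 C' hC'
        exact hgd c c' fun h => hne (h ▸ rfl)
      · intro C hC
        obtain ⟨c, hc, rfl⟩ := h𝒞 C hC
        rw [Finset.disjoint_left]
        intro v hv hvX
        obtain ⟨w, rfl, -⟩ := hgm' c v hv
        exact (hmem w).1 w.2 ((hXm _ w.1.2).1 hvX)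
      · intro C hC
        obtain ⟨c, hc, rfl⟩ := h𝒞 C hC
        rw [hgc]
        exact hc.1
      · intro C hC a ha b hb hab
        obtain ⟨c, hc, rfl⟩ := h𝒞 C hC
        have hbT : b ∈ T := by
          by_contra hbT
          exact hc.2 a ha ⟨b, hb, hab, hbT⟩
        by_cases hbX : b ∈ X
        · exact Or.inr hbX
        left
        have hbu : (⟨b, hbT⟩ : T) ∉ u := fun h => hbX ((hXm b hbT).2 h)
        obtain ⟨w, rfl, rfl⟩ := hgm' c a ha
        refine (hgm _ ⟨⟨b, hbT⟩, (hmem _).2 hbu⟩).2 ?_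
        rw [SimpleGraph.ConnectedComponent.eq]
        refine SimpleGraph.Adj.reachable ((hadj _ _).2 ⟨?_, Or.inl hab.symm⟩)
        rintro h
        exact hab.ne (congrArg Subtype.val h).symm
    have hlink : ∀ C ∈ 𝒞, IsLinked G C := by
      intro C hC K hK hne hneq
      obtain ⟨c, hc, rfl⟩ := h𝒞 C hC
      obtain ⟨k, hk⟩ := hne
      obtain ⟨v, hv, hvK⟩ := Finset.exists_of_ssubset (Finset.ssubset_iff_subset_ne.2 ⟨hK, hneq⟩)
      obtain ⟨k, rfl, hkc⟩ := hgm' c k (hK hk)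
      obtain ⟨v, rfl, hvc⟩ := hgm' c v hv
      obtain ⟨p⟩ := SimpleGraph.ConnectedComponent.eq.1 (hkc.trans hvc.symm)
      obtain ⟨e, -, he1, he2⟩ := p.exists_boundary_dart {w | f w ∈ K} hk hvK
      have hfst : f e.fst ∈ g c := hK he1
      have hsnd : f e.snd ∈ g c := by
        rw [hgm] at hfst ⊢
        rw [← hfst, SimpleGraph.ConnectedComponent.eq]
        exact e.adj.symm.reachable
      refine ⟨f e.fst, he1, f e.snd, hsnd, he2, ?_⟩
      rcases ((hadj _ _).1 e.adj).2 with h | h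
      · exact h
      · exact absurd h.1 (hc.2 _ hfst)
    have hle := hU X 𝒞 hbar hlink
    have hO : Hu.oddComponents ⊆ O₁ ∪ O₂ := by
      intro c hc
      by_cases h : ∃ v ∈ g c, S v
      · exact Or.inr h
      · push Not at h
        exact Or.inl ⟨hc, h⟩
    have hO' : Hu.oddComponents.ncard ≤ O₁.ncard + O₂.ncard :=
      (ncard_le_ncard hO).trans (ncard_union_le _ _)
    have hO₂ : O₂.ncard ≤ 1 := by
      rw [ncard_le_one]
      rintro c ⟨v, hv, hvS⟩ c' ⟨v', hv', hvS'⟩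
      obtain ⟨w, rfl, rfl⟩ := hgm' c v hv
      obtain ⟨w', rfl, rfl⟩ := hgm' c' v' hv'
      by_cases hww : w = w'
      · rw [hww]
      rw [SimpleGraph.ConnectedComponent.eq]
      refine SimpleGraph.Adj.reachable ((hadj _ _).2 ⟨?_, Or.inr ⟨hvS, hvS'⟩⟩)
      exact fun h => hww (Subtype.ext h)
    have hlt : u.ncard < Hu.oddComponents.ncard := hu
    rcases hT with hT | hT
    · have hcard : Nat.card ((⊤ : H.Subgraph).deleteVerts u).verts + u.ncard = T.card := by
        have : ((⊤ : H.Subgraph).deleteVerts u).verts = uᶜ := by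
          ext v
          exact hmem v
        rw [this, Nat.card_coe_set_eq, add_comm, ncard_add_ncard_compl, Nat.card_eq_fintype_card,
          Fintype.card_coe]
      have hpar := SimpleGraph.odd_ncard_oddComponents (G := Hu)
      refine not_lt_of_parity hcard hT hpar hlt ?_
      exact hO'.trans (by omega)
    · have : O₂ = ∅ := by
        rw [eq_empty_iff_forall_notMem]
        rintro c ⟨v, hv, w, hw, hvw, hwT⟩
        exact hwT (hT v (hgT c hv) w hw hvw)
      rw [this, ncard_empty] at hO'
      omega
  obtain ⟨M, hM⟩ := hM
  rw [SimpleGraph.Subgraph.isPerfectMatching_iff] at hM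
  choose p hp hpu using hM
  refine ⟨fun v => if h : v ∈ T then p ⟨v, h⟩ else v, fun v hv => ?_⟩
  have h1 := (M.adj_sub (hp ⟨v, hv⟩))
  simp only [hv, dif_pos, SetLike.coe_mem, Subtype.coe_eta]
  refine ⟨trivial, fun h => h1.1 (Subtype.ext h.symm), ?_, fun h => ?_⟩
  · exact congrArg Subtype.val (hpu _ _ (hp ⟨v, hv⟩).symm).symm
  · rcases h1.2 with h2 | ⟨⟨w, hw, hvw, hwT⟩, -⟩
    · exact h2
    · exact absurd (h w hw hvw) hwT

lemma even_card_of_involution {V : Type*} {C : Finset V} (P : V → V) (hPC : ∀ v ∈ C, P v ∈ C)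
    (hne : ∀ v ∈ C, P v ≠ v) (hPP : ∀ v ∈ C, P (P v) = v) : Even C.card := by
  have h : ∑ _v ∈ C, (1 : ZMod 2) = 0 :=
    Finset.sum_involution (fun v _ => P v) (fun _ _ => by decide) (fun v hv _ => hne v hv)
      hPC hPP
  rw [Finset.sum_const, nsmul_one] at h
  exact (ZMod.natCast_eq_zero_iff_even).1 h

/-- Under Tutte's condition every vertex has a neighbour such that Tutte's condition survives the
deletion of both. -/
lemma exists_partner {V : Type*} {G : SimpleGraph V} (hLF : ∀ v, (G.neighborSet v).Finite)
    {U : Set V} (hU : ∀ X 𝒞, IsBarrier G U X 𝒞 → (∀ C ∈ 𝒞, IsLinked G C) → 𝒞.card ≤ X.card)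
    {x : V} (hx : x ∈ U) :
    ∃ y ∈ U, G.Adj x y ∧ ∀ X 𝒞, IsBarrier G (U \ {x, y}) X 𝒞 → 𝒞.card ≤ X.card := by
  classical
  by_contra! hcon
  choose! X 𝒞 hb hlt using hcon
  let nb : V → Finset V := fun v => (hLF v).toFinset
  have hnb : ∀ v w, w ∈ nb v ↔ G.Adj v w := by simp [nb]
  let B : Finset V := insert x ((nb x).biUnion fun y => barrierSupport (X y) (𝒞 y))
  let T₀ : Finset V := (B ∪ B.biUnion nb).filter (· ∈ U)
  have hT₀ : ∀ v ∈ B, (v ∈ U → v ∈ T₀) ∧ ∀ w ∈ U, G.Adj v w → w ∈ T₀ := fun v hv =>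
    ⟨fun h => Finset.mem_filter.2 ⟨Finset.mem_union_left _ hv, h⟩, fun w hw hvw =>
      Finset.mem_filter.2 ⟨Finset.mem_union_right _
        (Finset.mem_biUnion.2 ⟨v, hv, (hnb _ _).2 hvw⟩), hw⟩⟩
  have hT₀U : ∀ v ∈ T₀, v ∈ U := fun v hv => (Finset.mem_filter.1 hv).2
  obtain ⟨T, hTT, hTU, hT⟩ : ∃ T : Finset V, T₀ ⊆ T ∧ ↑T ⊆ U ∧
      (Even T.card ∨ ∀ a ∈ T, ∀ b ∈ U, G.Adj a b → b ∈ T) := by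
    by_cases he : Even T₀.card
    · exact ⟨T₀, subset_rfl, hT₀U, .inl he⟩
    by_cases hz : ∃ z ∈ U, z ∉ T₀
    · obtain ⟨z, hz, hzT⟩ := hz
      refine ⟨insert z T₀, Finset.subset_insert _ _, ?_, .inl ?_⟩
      · intro v hv
        rcases Finset.mem_insert.1 hv with rfl | hv
        exacts [hz, hT₀U v hv]
      · rw [Finset.card_insert_of_notMem hzT, Nat.even_add_one]
        exact he
    · push Not at hz
      exact ⟨T₀, subset_rfl, hT₀U, .inr fun a _ b hb _ => hz b hb⟩
  obtain ⟨P, hP⟩ := exists_involution_of_tutte hU hTU hT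
  have hxB : x ∈ B := Finset.mem_insert_self _ _
  have hxT : x ∈ T := hTT ((hT₀ x hxB).1 hx)
  obtain ⟨hyT, -, hyx, hadj⟩ := hP x hxT
  replace hadj := hadj fun w hw h => hTT ((hT₀ x hxB).2 w hw h)
  have hyU : P x ∈ U := hTU hyT
  have hbar := hb (P x) hyU hadj
  have key : ∀ C ∈ 𝒞 (P x), ∃ c ∈ C, c ∈ T ∧ P c ∈ X (P x) := by
    intro C hC
    have hCB : ∀ v ∈ C, v ∈ B := fun v hv => Finset.mem_insert_of_mem
      (Finset.mem_biUnion.2 ⟨P x, (hnb _ _).2 hadj, mem_barrierSupport.2 (.inr ⟨C, hC, hv⟩)⟩)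
    have hCU : ∀ v ∈ C, v ∈ U \ {x, P x} := hbar.subset_of_mem C hC
    have hCT : ∀ v ∈ C, v ∈ T := fun v hv => hTT ((hT₀ v (hCB v hv)).1 (hCU v hv).1)
    by_contra! hX
    refine Nat.not_even_iff_odd.2 (hbar.odd C hC) (even_card_of_involution P (fun v hv => ?_)
      (fun v hv => (hP v (hCT v hv)).2.1) (fun v hv => (hP v (hCT v hv)).2.2.1))
    obtain ⟨h1, -, h3, h4⟩ := hP v (hCT v hv)
    have hvx := (hCU v hv).2
    refine (hbar.closed C hC v hv (P v) ⟨hTU h1, ?_⟩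
      (h4 fun w hw h => hTT ((hT₀ v (hCB v hv)).2 w hw h))).resolve_right (hX v hv (hCT v hv))
    rintro (h | h)
    · exact hvx (.inr (by rw [mem_singleton_iff, ← h3, h]))
    · rw [mem_singleton_iff] at h
      exact hvx (.inl (by rw [← h3, h, hyx]))
  have : Nonempty V := ⟨x⟩
  choose! f hfC hfT hfX using key
  refine (hlt (P x) hyU hadj).not_ge (Finset.card_le_card_of_injOn (fun C => P (f C)) hfX ?_)
  intro C hC C' hC' h
  by_contra hne
  refine Finset.disjoint_left.1 (hbar.disjoint C hC C' hC' hne) (hfC C hC) ?_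
  have h2 : f C = f C' := by
    rw [← (hP _ (hfT C hC)).2.2.1, ← (hP _ (hfT C' hC')).2.2.1]
    exact congrArg P h
  exact h2 ▸ hfC C' hC'

/-- `x` and `y` are at distance at most `r` in `G`. -/
def Near {V : Type*} (G : SimpleGraph V) (r : ℕ) (x y : V) : Prop :=
  ∃ p : G.Walk x y, p.length ≤ r

lemma Near.symm {V : Type*} {G : SimpleGraph V} {r : ℕ} {x y : V} (h : Near G r x y) :
    Near G r y x := by
  obtain ⟨p, hp⟩ := h
  exact ⟨p.reverse, by simpa⟩

lemma Near.trans {V : Type*} {G : SimpleGraph V} {r s : ℕ} {x y z : V} (h : Near G r x y)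
    (h' : Near G s y z) : Near G (r + s) x z := by
  obtain ⟨p, hp⟩ := h
  obtain ⟨q, hq⟩ := h'
  exact ⟨p.append q, by rw [SimpleGraph.Walk.length_append]; omega⟩

lemma Near.mono {V : Type*} {G : SimpleGraph V} {r s : ℕ} {x y : V} (h : Near G r x y)
    (hrs : r ≤ s) : Near G s x y :=
  h.imp fun _ hp => hp.trans hrs

lemma SimpleGraph.Adj.near {V : Type*} {G : SimpleGraph V} {x y : V} (h : G.Adj x y) :
    Near G 1 x y :=
  ⟨h.toWalk, by simp⟩

lemma IsLinked.union {V : Type*} [DecidableEq V] {G : SimpleGraph V} {F Y : Finset V}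
    (hF : IsLinked G F)
    (hY : ∀ v ∈ Y, ∃ w ∈ Y, ∃ f ∈ F, (v = w ∨ G.Adj v w) ∧ G.Adj w f) :
    IsLinked G (F ∪ Y) := by
  intro K hK hne hKF
  by_contra! hcl
  have hiff : ∀ a ∈ F ∪ Y, ∀ b ∈ F ∪ Y, G.Adj a b → (a ∈ K ↔ b ∈ K) := by
    intro a ha b hb hab
    constructor
    · intro haK
      by_contra hbK
      exact hcl a haK b hb hbK hab
    · intro hbK
      by_contra haK
      exact hcl b hbK a ha haK hab.symm
  have hex : ∀ v ∈ F ∪ Y, ∃ f ∈ F, v ∈ K ↔ f ∈ K := by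
    intro v hv
    rcases Finset.mem_union.1 hv with hv | hv
    · exact ⟨v, hv, Iff.rfl⟩
    · obtain ⟨w, hw, f, hf, hvw, hwf⟩ := hY v hv
      refine ⟨f, hf, ?_⟩
      have h1 := hiff w (Finset.mem_union_right _ hw) f (Finset.mem_union_left _ hf) hwf
      rcases hvw with rfl | hvw
      · exact h1
      · exact (hiff v (Finset.mem_union_right _ hv) w (Finset.mem_union_right _ hw) hvw).trans h1
  obtain ⟨k, hk⟩ := hne
  obtain ⟨v, hv, hvK⟩ := Finset.exists_of_ssubset (Finset.ssubset_iff_subset_ne.2 ⟨hK, hKF⟩)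
  obtain ⟨f, hf, hfk⟩ := hex k (hK hk)
  obtain ⟨f', hf', hfv⟩ := hex v hv
  obtain ⟨a, ha, b, hb, hbK, hab⟩ := hF (F ∩ K) Finset.inter_subset_left
    ⟨f, Finset.mem_inter.2 ⟨hf, hfk.1 hk⟩⟩
    (fun h => hvK (hfv.2 (Finset.inter_eq_left.1 h hf')))
  have h := hiff a (Finset.mem_union_left _ (Finset.mem_inter.1 ha).1) b
    (Finset.mem_union_left _ hb) hab
  exact hbK (Finset.mem_inter.2 ⟨hb, h.1 (Finset.mem_inter.1 ha).2⟩)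

open scoped Classical in
lemma IsLinked.lt_card_filter_near {V : Type*} {G : SimpleGraph V} {F : Finset V}
    (hF : IsLinked G F) {q x : V} {a : ℕ} (hx : x ∈ F) (hqx : Near G a q x) (s : ℕ)
    {y : V} (hy : y ∈ F) (hqy : ¬ Near G (a + s) q y) :
    s < (F.filter (Near G (a + s) q)).card := by
  induction s with
  | zero => exact Finset.card_pos.2 ⟨x, Finset.mem_filter.2 ⟨hx, hqx⟩⟩
  | succ s ih =>
    have hqy' : ¬ Near G (a + s) q y := fun h => hqy (h.mono (by omega))
    obtain ⟨u, hu, v, hv, hvu, huv⟩ := hF (F.filter (Near G (a + s) q)) (Finset.filter_subset _ _)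
      ⟨x, Finset.mem_filter.2 ⟨hx, hqx.mono (by omega)⟩⟩
      (fun h => hqy' (Finset.mem_filter.1 (h.ge hy)).2)
    refine (Nat.succ_le_of_lt (ih hqy')).trans_lt (Finset.card_lt_card ?_)
    refine (Finset.ssubset_iff_of_subset ?_).2 ⟨v, ?_, hvu⟩
    · intro z hz
      obtain ⟨h1, h2⟩ := Finset.mem_filter.1 hz
      exact Finset.mem_filter.2 ⟨h1, h2.mono (by omega)⟩
    · exact Finset.mem_filter.2 ⟨hv, (Finset.mem_filter.1 hu).2.trans huv.near⟩

lemma IsLinked.mul_card_le {V : Type*} {G : SimpleGraph V} {F : Finset V}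
    (hF : IsLinked G F) {Q : Finset V} {a s r : ℕ} (hr : 2 * (a + s) ≤ r)
    (hQ : ∀ q ∈ Q, ∀ q' ∈ Q, Near G r q q' → q = q')
    (hQF : ∀ q ∈ Q, ∃ f ∈ F, Near G a q f) (hQ2 : 2 ≤ Q.card) : s * Q.card ≤ F.card := by
  classical
  have hlt : ∀ q ∈ Q, s ≤ (F.filter (Near G (a + s) q)).card := by
    intro q hq
    obtain ⟨q', hq', hne⟩ := Finset.exists_mem_ne hQ2 q
    obtain ⟨f, hf, hqf⟩ := hQF q hq
    obtain ⟨f', hf', hqf'⟩ := hQF q' hq'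
    refine (hF.lt_card_filter_near hf hqf s hf' fun h => hne ?_).le
    exact (hQ q hq q' hq' ((h.trans hqf'.symm).mono (by omega))).symm
  rw [mul_comm]
  refine (Finset.card_nsmul_le_sum _ _ _ hlt).trans ?_
  rw [← Finset.card_biUnion]
  · exact Finset.card_le_card (Finset.biUnion_subset.2 fun _ _ => Finset.filter_subset _ _)
  · intro q hq q' hq' hne
    rw [Function.onFun, Finset.disjoint_left]
    intro z hz hz'
    exact hne (hQ q hq q' hq' (((Finset.mem_filter.1 hz).2.trans
      (Finset.mem_filter.1 hz').2.symm).mono (by omega)))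

/-- Deleting a sufficiently sparse set of edges, each of which preserves Tutte's condition on its
own, preserves robustness. -/
lemma IsRobust.exists_sdiff {V : Type*} {G : SimpleGraph V} (hLF : ∀ v, (G.neighborSet v).Finite)
    {U : Set V} (hU : IsRobust G U) :
    ∃ r : ℕ, ∀ (A : Set V) (e : V → V), A ⊆ U →
      (∀ x ∈ A, ∀ y ∈ A, Near G r x y → x = y) →
      (∀ x ∈ A, e x ∈ U ∧ G.Adj x (e x) ∧ ∀ X 𝒞, IsBarrier G (U \ {x, e x}) X 𝒞 →
        (∀ v ∈ barrierSupport X 𝒞, G.Reachable x v) → 𝒞.card ≤ X.card) →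
      IsRobust G (U \ (A ∪ e '' A)) := by
  classical
  obtain ⟨ε, hε, m, hm⟩ := hU
  obtain ⟨k, hk⟩ := exists_nat_ge (4 / ε)
  let s := max (max m k) 1
  have hsm : m ≤ s := (le_max_left _ _).trans (le_max_left _ _)
  have hs1 : 1 ≤ s := le_max_right _ _
  have hsk : 4 ≤ ε * s := by
    have : (k : ℝ) ≤ s := by exact_mod_cast (le_max_right m k).trans (le_max_left _ _)
    rw [div_le_iff₀ hε] at hk
    nlinarith
  refine ⟨2 * (2 + s), fun A e hA hd he => ⟨ε / 2, by positivity, s, fun X 𝒞 hb hl hF => ?_⟩⟩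
  set F := barrierSupport X 𝒞 with hFdef
  have hCF : ∀ C ∈ 𝒞, ∀ v ∈ C, v ∈ F := fun C hC v hv => mem_barrierSupport.2 (.inr ⟨C, hC, hv⟩)
  let Q' : Set V := {q | q ∈ A ∧ ∃ f ∈ F, G.Adj f q ∨ G.Adj f (e q)}
  have hQfin : Q'.Finite := by
    let N := ⋃ f ∈ F, G.neighborSet f
    have hN : N.Finite := F.finite_toSet.biUnion fun f _ => hLF f
    refine (hN.union (hN.biUnion fun v _ => hLF v)).subset ?_
    rintro q ⟨hq, f, hf, h | h⟩
    · exact .inl (mem_biUnion hf h)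
    · exact .inr (mem_biUnion (mem_biUnion hf h) (he q hq).2.1.symm)
  let Q := hQfin.toFinset
  have hQ : ∀ q, q ∈ Q ↔ q ∈ A ∧ ∃ f ∈ F, G.Adj f q ∨ G.Adj f (e q) := fun q => by simp [Q, Q']
  let Y := Q ∪ Q.image e
  have hYc : Y.card ≤ 2 * Q.card := by
    have h1 := Finset.card_union_le Q (Q.image e)
    have h2 : (Q.image e).card ≤ Q.card := Finset.card_image_le
    change (Q ∪ Q.image e).card ≤ _
    omega
  have hout : ∀ a ∈ F, ∀ b ∈ U, G.Adj a b → b ∉ Y → b ∈ U \ (A ∪ e '' A) := by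
    intro a ha b hb hab hbY
    refine ⟨hb, ?_⟩
    rintro (h | ⟨q, h, rfl⟩)
    · exact hbY (Finset.mem_union_left _ ((hQ b).2 ⟨h, a, ha, .inl hab⟩))
    · exact hbY (Finset.mem_union_right _
        (Finset.mem_image_of_mem _ ((hQ q).2 ⟨h, a, ha, .inr hab⟩)))
  have hYA : ∀ v ∈ Y, v ∈ U ∧ v ∈ A ∪ e '' A := by
    intro v hv
    rcases Finset.mem_union.1 hv with hv | hv
    · have := ((hQ v).1 hv).1
      exact ⟨hA this, .inl this⟩
    · obtain ⟨q, hq, rfl⟩ := Finset.mem_image.1 hv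
      have := ((hQ q).1 hq).1
      exact ⟨(he q this).1, .inr ⟨q, this, rfl⟩⟩
  have hbU : IsBarrier G U (X ∪ Y) 𝒞 := by
    refine ⟨?_, fun C hC v hv => (hb.subset_of_mem C hC hv).1, hb.disjoint, fun C hC => ?_,
      hb.odd, fun C hC a ha b hbU hab => ?_⟩
    · intro v hv
      rcases Finset.mem_union.1 hv with hv | hv
      · exact (hb.subset hv).1
      · exact (hYA v hv).1
    · refine Finset.disjoint_union_right.2 ⟨hb.disjoint_left C hC, ?_⟩
      exact Finset.disjoint_left.2 fun v hv hvY => (hb.subset_of_mem C hC hv).2 (hYA v hvY).2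
    · by_cases hbY : b ∈ Y
      · exact .inr (Finset.mem_union_right _ hbY)
      · exact (hb.closed C hC a ha b (hout a (hCF C hC a ha) b hbU hab hbY) hab).imp_right
          (Finset.mem_union_left _)
  have hsupp : barrierSupport (X ∪ Y) 𝒞 = F ∪ Y := by
    ext v
    simp only [hFdef, mem_barrierSupport, Finset.mem_union]
    exact or_right_comm
  have hFY : IsLinked G (F ∪ Y) := by
    refine hF.union fun v hv => ?_
    obtain ⟨q, hq, hvq⟩ : ∃ q ∈ Q, v = q ∨ v = e q := by
      rcases Finset.mem_union.1 hv with hv | hv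
      · exact ⟨v, hv, .inl rfl⟩
      · obtain ⟨q, hq, rfl⟩ := Finset.mem_image.1 hv
        exact ⟨q, hq, .inr rfl⟩
    have hqY : q ∈ Y := Finset.mem_union_left _ hq
    have heY : e q ∈ Y := Finset.mem_union_right _ (Finset.mem_image_of_mem _ hq)
    obtain ⟨hqA, f, hf, h⟩ := (hQ q).1 hq
    have hqe := (he q hqA).2.1
    rcases h with h | h
    · refine ⟨q, hqY, f, hf, ?_, h.symm⟩
      rcases hvq with rfl | rfl
      exacts [.inl rfl, .inr hqe.symm]
    · refine ⟨e q, heY, f, hf, ?_, h.symm⟩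
      rcases hvq with rfl | rfl
      exacts [.inr hqe, .inl rfl]
  obtain ⟨hweak, hstrong⟩ := hm (X ∪ Y) 𝒞 hbU hl (hsupp ▸ hFY)
  rw [hsupp] at hstrong
  have hXY := Finset.card_union_le X Y
  have hFF : F.card ≤ (F ∪ Y).card := Finset.card_le_card Finset.subset_union_left
  have hbig : s ≤ F.card → s * Q.card ≤ F.card → (𝒞.card : ℝ) + ε / 2 * F.card ≤ X.card := by
    intro h1 h2
    have h3 := hstrong (by omega)
    have h4 : ((X ∪ Y).card : ℝ) ≤ X.card + 2 * Q.card := by exact_mod_cast (by omega)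
    have h5 : (F.card : ℝ) ≤ (F ∪ Y).card := by exact_mod_cast hFF
    have h6 : (s : ℝ) * Q.card ≤ F.card := by exact_mod_cast h2
    have h7 : (0 : ℝ) ≤ Q.card := by positivity
    nlinarith
  have hQF : ∀ q ∈ Q, ∃ f ∈ F, Near G 2 q f := by
    intro q hq
    obtain ⟨hqA, f, hf, h | h⟩ := (hQ q).1 hq
    · exact ⟨f, hf, h.symm.near.mono (by omega)⟩
    · exact ⟨f, hf, (he q hqA).2.1.near.trans h.symm.near⟩
  have hsQ : 2 ≤ Q.card → s * Q.card ≤ F.card :=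
    hF.mul_card_le le_rfl (fun q hq q' hq' => hd q ((hQ q).1 hq).1 q' ((hQ q').1 hq').1) hQF
  constructor
  · rcases Nat.lt_or_ge Q.card 2 with h | h
    · rcases Nat.lt_or_ge Q.card 1 with h0 | h1
      · omega
      obtain ⟨q, hQq⟩ := Finset.card_eq_one.1 (by omega : Q.card = 1)
      have hq : q ∈ Q := hQq ▸ Finset.mem_singleton_self q
      have hqA := ((hQ q).1 hq).1
      obtain ⟨f, hf, p, -⟩ := hQF q hq
      have hdel : ∀ v ∈ U \ (A ∪ e '' A), v ∈ U \ {q, e q} := by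
        rintro v ⟨hvU, hv⟩
        refine ⟨hvU, ?_⟩
        rintro (rfl | rfl)
        exacts [hv (.inl hqA), hv (.inr ⟨q, hqA, rfl⟩)]
      refine (he q hqA).2.2 X 𝒞 ⟨fun v hv => hdel v (hb.subset hv),
        fun C hC v hv => hdel v (hb.subset_of_mem C hC hv), hb.disjoint, hb.disjoint_left, hb.odd,
        fun C hC a ha b hbU hab => ?_⟩ fun v hv => p.reachable.trans (hF.reachable hf hv)
      refine hb.closed C hC a ha b (hout a (hCF C hC a ha) b hbU.1 hab fun hbY => hbU.2 ?_) hab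
      simpa [Y, hQq] using hbY
    · have h1 := hsQ h
      have h2 := hbig (by nlinarith) h1
      have h3 : (0 : ℝ) ≤ ε / 2 * F.card := by positivity
      exact_mod_cast (by linarith : (𝒞.card : ℝ) ≤ X.card)
  · intro h
    refine hbig h ?_
    rcases Nat.lt_or_ge Q.card 2 with h2 | h2
    · nlinarith
    · exact hsQ h2

lemma IsBarrier.image {ι V : Type*} [DecidableEq V] {H : SimpleGraph ι} {G : SimpleGraph V}
    {W : Set ι} {U : Set V} {φ : ι → V} (hφ : InjOn φ W) (hWU : MapsTo φ W U)
    (hcl : ∀ a ∈ W, ∀ b ∈ U, G.Adj (φ a) b → ∃ c ∈ W, φ c = b ∧ H.Adj a c)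
    {X : Finset ι} {𝒞 : Finset (Finset ι)} (h : IsBarrier H W X 𝒞) :
    IsBarrier G U (X.image φ) (𝒞.image (Finset.image φ)) ∧ (X.image φ).card = X.card ∧
      (𝒞.image (Finset.image φ)).card = 𝒞.card := by
  classical
  have hmem : ∀ (C : Finset ι), ↑C ⊆ W → ∀ a ∈ W, φ a ∈ C.image φ → a ∈ C := by
    intro C hC a ha haC
    obtain ⟨b, hb, hba⟩ := Finset.mem_image.1 haC
    exact hφ (hC hb) ha hba ▸ hb
  have hdis : ∀ C D : Finset ι, ↑C ⊆ W → ↑D ⊆ W → Disjoint C D →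
      Disjoint (C.image φ) (D.image φ) := by
    intro C D hC hD hCD
    rw [Finset.disjoint_left]
    intro v hv hvD
    obtain ⟨a, ha, rfl⟩ := Finset.mem_image.1 hv
    exact Finset.disjoint_left.1 hCD ha (hmem D hD a (hC ha) hvD)
  refine ⟨⟨?_, ?_, ?_, ?_, ?_, ?_⟩, Finset.card_image_of_injOn (hφ.mono h.subset),
    Finset.card_image_of_injOn ?_⟩
  · intro v hv
    obtain ⟨a, ha, rfl⟩ := Finset.mem_image.1 hv
    exact hWU (h.subset ha)
  · rintro D hD v hv
    obtain ⟨C, hC, rfl⟩ := Finset.mem_image.1 hD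
    obtain ⟨a, ha, rfl⟩ := Finset.mem_image.1 hv
    exact hWU (h.subset_of_mem C hC ha)
  · intro D hD D' hD' hne
    obtain ⟨C, hC, rfl⟩ := Finset.mem_image.1 hD
    obtain ⟨C', hC', rfl⟩ := Finset.mem_image.1 hD'
    exact hdis C C' (h.subset_of_mem C hC) (h.subset_of_mem C' hC')
      (h.disjoint C hC C' hC' fun h => hne (h ▸ rfl))
  · intro D hD
    obtain ⟨C, hC, rfl⟩ := Finset.mem_image.1 hD
    exact hdis C X (h.subset_of_mem C hC) h.subset (h.disjoint_left C hC)
  · intro D hD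
    obtain ⟨C, hC, rfl⟩ := Finset.mem_image.1 hD
    rw [Finset.card_image_of_injOn (hφ.mono (h.subset_of_mem C hC))]
    exact h.odd C hC
  · intro D hD v hv b hb hvb
    obtain ⟨C, hC, rfl⟩ := Finset.mem_image.1 hD
    obtain ⟨a, ha, rfl⟩ := Finset.mem_image.1 hv
    obtain ⟨c, hc, rfl, hac⟩ := hcl a (h.subset_of_mem C hC ha) b hb hvb
    exact (h.closed C hC a ha c hc hac).imp (Finset.mem_image_of_mem _)
      (Finset.mem_image_of_mem _)
  · intro C hC C' hC' hCC
    by_contra hne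
    obtain ⟨a, ha⟩ : C.Nonempty := Finset.card_pos.1 (h.odd C hC).pos
    refine Finset.disjoint_left.1 (h.disjoint C hC C' hC' hne) ha ?_
    exact hmem C' (h.subset_of_mem C' hC') a (h.subset_of_mem C hC ha)
      (hCC ▸ Finset.mem_image_of_mem φ ha)

/-- Bounded-distance reachability in a Borel graph is exhausted by countably many Borel maps. -/
lemma exists_measurable_near {V : Type*} [MeasurableSpace V] [StandardBorelSpace V]
    {G : SimpleGraph V} (hG : MeasurableSet {p : V × V | G.Adj p.1 p.2}) {d : ℕ}
    (hLF : ∀ v, (G.neighborSet v).Finite) (hdeg : ∀ v, (G.neighborSet v).ncard ≤ d) :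
    ∃ w : List ℕ → V → V, (∀ l, Measurable (w l)) ∧ (∀ l x, Near G l.length x (w l x)) ∧
      ∀ r x y, Near G r x y → ∃ l, l.length ≤ r ∧ w l x = y := by
  obtain ⟨g, hgm, hg, hg'⟩ := exists_measurable_enum hG d hLF hdeg
  refine ⟨fun l => l.foldr (fun n f => f ∘ g n) id, fun l => ?_, fun l => ?_, fun r x y => ?_⟩
  · induction l with
    | nil => exact measurable_id
    | cons n l ih => exact ih.comp (hgm n)
  · induction l with
    | nil => exact fun x => ⟨.nil, le_rfl⟩
    | cons n l ih =>
      intro x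
      have h := ih (g n x)
      rcases hg n x with hx | hx
      · rw [hx] at h
        simpa [hx] using h.mono (Nat.le_succ _)
      · have := (SimpleGraph.Adj.near (G := G) hx).trans h
        rw [add_comm] at this
        exact this
  · rintro ⟨p, hp⟩
    suffices ∃ l : List ℕ, l.length ≤ p.length ∧ l.foldr (fun n f => f ∘ g n) id x = y from
      this.imp fun l h => ⟨h.1.trans hp, h.2⟩
    clear hp
    induction p with
    | nil => exact ⟨[], le_rfl, rfl⟩
    | cons h p ih =>
      obtain ⟨l, hl, rfl⟩ := ih
      obtain ⟨n, rfl⟩ := hg' _ _ h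
      exact ⟨n :: l, by simpa using hl, rfl⟩

lemma exists_measurable_reachable {V : Type*} [MeasurableSpace V] [StandardBorelSpace V]
    {G : SimpleGraph V} (hG : MeasurableSet {p : V × V | G.Adj p.1 p.2}) {d : ℕ}
    (hLF : ∀ v, (G.neighborSet v).Finite) (hdeg : ∀ v, (G.neighborSet v).ncard ≤ d) :
    ∃ γ : ℕ → V → V, (∀ n, Measurable (γ n)) ∧ ∀ x y, G.Reachable x y ↔ ∃ n, γ n x = y := by
  obtain ⟨w, hw, hwl, hwr⟩ := exists_measurable_near hG hLF hdeg
  refine ⟨fun n => w (Denumerable.ofNat (List ℕ) n), fun n => hw _,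
    fun x y => ⟨fun ⟨p⟩ => ?_, ?_⟩⟩
  · obtain ⟨l, -, hl⟩ := hwr p.length x y ⟨p, le_rfl⟩
    exact ⟨Encodable.encode l, by simpa using hl⟩
  · rintro ⟨n, rfl⟩
    obtain ⟨p, -⟩ := hwl (Denumerable.ofNat (List ℕ) n) x
    exact p.reachable

lemma finite_setOf_near {V : Type*} {G : SimpleGraph V} (hLF : ∀ v, (G.neighborSet v).Finite)
    (r : ℕ) (x : V) : {y | Near G r x y}.Finite := by
  induction r generalizing x with
  | zero =>
    refine (finite_singleton x).subset ?_
    rintro y ⟨p, hp⟩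
    exact (SimpleGraph.Walk.eq_of_length_eq_zero (Nat.le_zero.1 hp)).symm
  | succ r ih =>
    refine ((finite_singleton x).union ((hLF x).biUnion fun z _ => ih z)).subset ?_
    rintro y ⟨p, hp⟩
    cases p with
    | nil => exact .inl rfl
    | cons h p => exact .inr (mem_biUnion h ⟨p, by simpa using hp⟩)

/-- A locally finite Borel graph is covered by countably many Borel `r`-discrete sets. -/
lemma exists_discrete_cover {V : Type*} [TopologicalSpace V] [T1Space V]
    [SecondCountableTopology V] [MeasurableSpace V] [OpensMeasurableSpace V]
    [MeasurableEq V] {G : SimpleGraph V}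
    (hLF : ∀ v, (G.neighborSet v).Finite) {w : List ℕ → V → V} (hw : ∀ l, Measurable (w l))
    (hw' : ∀ l x, Near G l.length x (w l x))
    (hwr : ∀ r x y, Near G r x y → ∃ l, l.length ≤ r ∧ w l x = y) (r : ℕ) :
    ∃ C : TopologicalSpace.countableBasis V → Set V, (∀ k, MeasurableSet (C k)) ∧
      (∀ k, ∀ x ∈ C k, ∀ y ∈ C k, Near G r x y → x = y) ∧ ∀ x, ∃ k, x ∈ C k := by
  have hbasis := TopologicalSpace.isBasis_countableBasis V
  refine ⟨fun O => {x | x ∈ (O : Set V) ∧ ∀ l : List ℕ, l.length ≤ r → w l x ∈ (O : Set V) →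
    w l x = x}, fun O => ?_, fun O x hx y hy hxy => ?_, fun x => ?_⟩
  · have hO : MeasurableSet (O : Set V) := (hbasis.isOpen O.2).measurableSet
    have : {x | x ∈ (O : Set V) ∧ ∀ l : List ℕ, l.length ≤ r → w l x ∈ (O : Set V) →
        w l x = x} =
        ↑O ∩ ⋂ l : List ℕ, ⋂ _ : l.length ≤ r, (w l ⁻¹' (O : Set V))ᶜ ∪ {x | w l x = x} := by
      ext x
      simp only [mem_inter_iff, mem_iInter, mem_union, mem_compl_iff, mem_preimage,
        ← imp_iff_not_or]
      rfl
    beta_reduce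
    rw [this]
    exact hO.inter (.iInter fun l => .iInter fun _ =>
      ((hw l hO).compl).union (measurableSet_eq_fun (hw l) measurable_id))
  · obtain ⟨l, hl, rfl⟩ := hwr r x y hxy
    exact (hx.2 l hl hy.1).symm
  · have hfin := (finite_setOf_near hLF r x).sdiff (t := {x})
    obtain ⟨O, hO, hxO, hOs⟩ := hbasis.exists_subset_of_mem_open
      (show x ∈ ({y | Near G r x y} \ {x})ᶜ from fun h => h.2 rfl) hfin.isClosed.isOpen_compl
    refine ⟨⟨O, hO⟩, hxO, fun l hl hlO => ?_⟩
    by_contra hne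
    exact hOs hlO ⟨(hw' l x).mono hl, hne⟩

/-- `y` is a neighbour of `x` in `U` such that Tutte's condition holds in the component of `x` after
deleting `x` and `y` from `U`. -/
def IsPartner {V : Type*} (G : SimpleGraph V) (U : Set V) (x y : V) : Prop :=
  y ∈ U ∧ G.Adj x y ∧ ∀ X 𝒞, IsBarrier G (U \ {x, y}) X 𝒞 →
    (∀ v ∈ barrierSupport X 𝒞, G.Reachable x v) → 𝒞.card ≤ X.card

lemma measurable_isBarrier {V ι : Type*} [MeasurableSpace V] [Countable ι]
    {H : V → SimpleGraph ι} {W : V → Set ι} (hH : ∀ i j, Measurable fun z => (H z).Adj i j)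
    (hW : ∀ i, Measurable fun z => i ∈ W z) (X : Finset ι) (𝒞 : Finset (Finset ι)) :
    Measurable fun z => IsBarrier (H z) (W z) X 𝒞 := by
  have : (fun z => IsBarrier (H z) (W z) X 𝒞) = fun z =>
      (∀ i, i ∈ X → i ∈ W z) ∧ (∀ C, C ∈ 𝒞 → ∀ i, i ∈ C → i ∈ W z) ∧
      (∀ C ∈ 𝒞, ∀ C' ∈ 𝒞, C ≠ C' → Disjoint C C') ∧ (∀ C ∈ 𝒞, Disjoint C X) ∧
      (∀ C ∈ 𝒞, Odd C.card) ∧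
      (∀ C, C ∈ 𝒞 → ∀ i, i ∈ C → ∀ j, j ∈ W z → (H z).Adj i j → j ∈ C ∨ j ∈ X) := by
    funext z
    exact propext ⟨fun h => ⟨h.1, h.2, h.3, h.4, h.5, h.6⟩,
      fun ⟨h1, h2, h3, h4, h5, h6⟩ => ⟨h1, h2, h3, h4, h5, h6⟩⟩
  rw [this]
  refine .and (.forall fun i => .imp measurable_const (hW i)) (.and ?_ (.and measurable_const
    (.and measurable_const (.and measurable_const ?_))))
  · exact .forall fun C => .imp measurable_const (.forall fun i => .imp measurable_const (hW i))
  · exact .forall fun C => .imp measurable_const (.forall fun i => .imp measurable_const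
      (.forall fun j => .imp (hW j) (.imp (hH i j) measurable_const)))

lemma measurableSet_isPartner {V : Type*} [MeasurableSpace V] [MeasurableEq V]
    {G : SimpleGraph V} (hG : MeasurableSet {p : V × V | G.Adj p.1 p.2})
    {γ : ℕ → V → V} (hγ : ∀ n, Measurable (γ n))
    (hγr : ∀ x y, G.Reachable x y ↔ ∃ n, γ n x = y) {U : Set V} (hU : MeasurableSet U)
    {e : V → V} (he : Measurable e) : MeasurableSet {z | IsPartner G U z (e z)} := by
  classical
  let W : V → Set ℕ := fun z => {i | (∀ j, j < i → γ j z ≠ γ i z) ∧ γ i z ∈ U ∧ γ i z ≠ z ∧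
    γ i z ≠ e z}
  have hWz : ∀ z i, i ∈ W z ↔ (∀ j, j < i → γ j z ≠ γ i z) ∧ γ i z ∈ U ∧ γ i z ≠ z ∧
    γ i z ≠ e z := fun _ _ => Iff.rfl
  let H : V → SimpleGraph ℕ := fun z => G.comap (γ · z)
  have hH : ∀ i j, Measurable fun z => (H z).Adj i j := fun i j =>
    measurableSet_setOfPred.1 (hG.preimage ((hγ i).prodMk (hγ j)))
  have heq : ∀ {f g : V → V}, Measurable f → Measurable g → Measurable fun z => f z ≠ g z :=
    fun hf hg => (measurableSet_setOfPred.1 (measurableSet_eq_fun hf hg)).not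
  have hW : ∀ i, Measurable fun z => i ∈ W z := fun i =>
    .and (.forall fun j => .imp measurable_const (heq (hγ j) (hγ i)))
      (.and (measurableSet_setOfPred.1 (hU.preimage (hγ i)))
        (.and (heq (hγ i) measurable_id) (heq (hγ i) he)))
  have key : ∀ z, IsPartner G U z (e z) ↔ e z ∈ U ∧ G.Adj z (e z) ∧
      ∀ (X : Finset ℕ) (𝒞 : Finset (Finset ℕ)), IsBarrier (H z) (W z) X 𝒞 → 𝒞.card ≤ X.card := by
    intro z
    have hc : ∀ v, ∃ n, G.Reachable z v → γ n z = v ∧ ∀ j < n, γ j z ≠ v := by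
      intro v
      by_cases hv : G.Reachable z v
      · have h := (hγr z v).1 hv
        exact ⟨Nat.find h, fun _ => ⟨Nat.find_spec h, fun j hj => Nat.find_min h hj⟩⟩
      · exact ⟨0, fun h => absurd h hv⟩
    choose c hc using hc
    have hcW : ∀ v, G.Reachable z v → v ∈ U \ {z, e z} → c v ∈ W z := by
      intro v hv hvU
      obtain ⟨h1, h2⟩ := hc v hv
      refine (hWz _ _).2 ⟨by rwa [h1], by rw [h1]; exact hvU.1, ?_, ?_⟩
      · rw [h1]
        exact fun h => hvU.2 (.inl h)
      · rw [h1]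
        exact fun h => hvU.2 (.inr h)
    refine and_congr_right fun _ => and_congr_right fun _ => ⟨fun h X 𝒞 hb => ?_,
      fun h X 𝒞 hb hr => ?_⟩
    · have hinj : InjOn (γ · z) (W z) := by
        intro i hi j hj hij
        rcases lt_trichotomy i j with h | h | h
        · exact absurd hij (hj.1 i h)
        · exact h
        · exact absurd hij.symm (hi.1 j h)
      have hmaps : MapsTo (γ · z) (W z) (U \ {z, e z}) := by
        rintro i ⟨-, h1, h2, h3⟩
        refine ⟨h1, ?_⟩
        rintro (h | h)
        exacts [h2 h, h3 h]
      obtain ⟨h1, h2, h3⟩ := hb.image (G := G) hinj hmaps (by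
        intro a _ b hb hab
        have hzb : G.Reachable z b := ((hγr z _).2 ⟨a, rfl⟩).trans hab.reachable
        have hcb := (hc b hzb).1
        refine ⟨c b, hcW b hzb hb, hcb, ?_⟩
        change G.Adj (γ a z) (γ (c b) z)
        rwa [hcb])
      rw [← h2, ← h3]
      refine h _ _ h1 fun v hv => (hγr z v).2 ?_
      rcases mem_barrierSupport.1 hv with hv | ⟨C, hC, hv⟩
      · obtain ⟨a, -, rfl⟩ := Finset.mem_image.1 hv
        exact ⟨a, rfl⟩
      · obtain ⟨C, -, rfl⟩ := Finset.mem_image.1 hC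
        obtain ⟨a, -, rfl⟩ := Finset.mem_image.1 hv
        exact ⟨a, rfl⟩
    · have hb' : IsBarrier G ((U \ {z, e z}) ∩ {v | G.Reachable z v}) X 𝒞 :=
        ⟨fun v hv => ⟨hb.subset hv, hr v (mem_barrierSupport.2 (.inl hv))⟩,
          fun C hC v hv => ⟨hb.subset_of_mem C hC hv,
            hr v (mem_barrierSupport.2 (.inr ⟨C, hC, hv⟩))⟩,
          hb.disjoint, hb.disjoint_left, hb.odd, fun C hC a ha b hbU => hb.closed C hC a ha b hbU.1⟩
      obtain ⟨h1, h2, h3⟩ := hb'.image (H := G) (G := H z) (φ := c) (U := W z) (by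
        intro u hu v hv huv
        rw [← (hc u hu.2).1, ← (hc v hv.2).1, huv])
        (fun v hv => hcW v hv.2 hv.1) (by
        intro a ha b hb hab
        have hcb : c (γ b z) = b := by
          have h := hc (γ b z) ((hγr z _).2 ⟨b, rfl⟩)
          by_contra hne
          rcases lt_or_gt_of_ne hne with hlt | hlt
          · exact hb.1 _ hlt h.1
          · exact h.2 b hlt rfl
        refine ⟨γ b z, ⟨⟨hb.2.1, ?_⟩, (hγr z _).2 ⟨b, rfl⟩⟩, hcb, ?_⟩
        · rintro (h | h)
          exacts [hb.2.2.1 h, hb.2.2.2 h]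
        · have hab : G.Adj (γ (c a) z) (γ b z) := hab
          rwa [(hc a ha.2).1] at hab)
      rw [← h2, ← h3]
      exact h _ _ h1
  simp_rw [key]
  refine measurableSet_setOfPred.2 (.and (measurableSet_setOfPred.1 (hU.preimage he)) (.and
    (measurableSet_setOfPred.1 (hG.preimage (measurable_id.prodMk he))) ?_))
  exact .forall fun X => .forall fun 𝒞 => .imp (measurable_isBarrier hH hW X 𝒞) measurable_const

/-- `N` is a Borel matching of `G` whose set of uncovered vertices is `U`, and `U` is robust. -/
structure IsPartialMatching {V : Type*} [MeasurableSpace V] (G : SimpleGraph V) (N : Set (V × V))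
    (U : Set V) : Prop where
  measurableSet : MeasurableSet N
  measurableSet_uncovered : MeasurableSet U
  adj : ∀ x y, (x, y) ∈ N → G.Adj x y
  symm : ∀ x y, (x, y) ∈ N → (y, x) ∈ N
  unique : ∀ x y z, (x, y) ∈ N → (x, z) ∈ N → y = z
  notMem_iff : ∀ x, x ∉ U ↔ ∃ y, (x, y) ∈ N
  robust : IsRobust G U

lemma IsPartialMatching.union {V : Type*} [MeasurableSpace V] [StandardBorelSpace V]
    {G : SimpleGraph V} {N : Set (V × V)} {U : Set V} (h : IsPartialMatching G N U)
    {A : Set V} (hA : MeasurableSet A) (hAU : A ⊆ U) {e : V → V} (he : Measurable e)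
    (heU : ∀ x ∈ A, e x ∈ U) (hadj : ∀ x ∈ A, G.Adj x (e x)) (hinj : InjOn e A)
    (heA : ∀ x ∈ A, e x ∉ A) (hrob : IsRobust G (U \ (A ∪ e '' A))) :
    IsPartialMatching G (N ∪ ({p | p.1 ∈ A ∧ e p.1 = p.2} ∪ {p | p.2 ∈ A ∧ e p.2 = p.1}))
      (U \ (A ∪ e '' A)) := by
  have hNU : ∀ x y, (x, y) ∈ N → x ∉ U := fun x y hxy => (h.notMem_iff x).2 ⟨y, hxy⟩
  have hmem : ∀ x y, (x, y) ∈ N ∪ ({p : V × V | p.1 ∈ A ∧ e p.1 = p.2} ∪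
      {p | p.2 ∈ A ∧ e p.2 = p.1}) ↔ (x, y) ∈ N ∨ (x ∈ A ∧ e x = y) ∨ (y ∈ A ∧ e y = x) :=
    fun _ _ => Iff.rfl
  constructor
  · refine h.measurableSet.union (.union ?_ ?_)
    · exact (measurable_fst hA).inter
        (measurableSet_eq_fun (he.comp measurable_fst) measurable_snd)
    · exact (measurable_snd hA).inter
        (measurableSet_eq_fun (he.comp measurable_snd) measurable_fst)
  · exact h.measurableSet_uncovered.diff (hA.union (hA.image_of_measurable_injOn he hinj))
  · intro x y hxy
    rcases (hmem x y).1 hxy with h1 | ⟨hx, rfl⟩ | ⟨hy, rfl⟩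
    exacts [h.adj x y h1, hadj x hx, (hadj y hy).symm]
  · intro x y hxy
    rcases (hmem x y).1 hxy with h1 | h1 | h1
    exacts [.inl (h.symm x y h1), .inr (.inr h1), .inr (.inl h1)]
  · intro x y z hxy hxz
    rcases (hmem x y).1 hxy with h1 | ⟨hx, rfl⟩ | ⟨hy, rfl⟩
    · rcases (hmem x z).1 hxz with h2 | ⟨hx, rfl⟩ | ⟨hz, rfl⟩
      exacts [h.unique x y z h1 h2, absurd (hAU hx) (hNU _ _ h1),
        absurd (heU z hz) (hNU _ _ h1)]
    · rcases (hmem x z).1 hxz with h2 | ⟨-, rfl⟩ | ⟨hz, rfl⟩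
      exacts [absurd (hAU hx) (hNU _ _ h2), rfl, absurd hx (heA z hz)]
    · rcases (hmem _ z).1 hxz with h2 | ⟨hx, rfl⟩ | ⟨hz, hzy⟩
      exacts [absurd (heU y hy) (hNU _ _ h2), absurd hx (heA y hy), (hinj hz hy hzy).symm]
  · intro x
    constructor
    · intro hx
      by_cases hxU : x ∈ U
      · have hx' : x ∈ A ∪ e '' A := by
          by_contra hx'
          exact hx ⟨hxU, hx'⟩
        rcases hx' with hx' | ⟨y, hy, rfl⟩
        exacts [⟨e x, .inr (.inl ⟨hx', rfl⟩)⟩, ⟨y, .inr (.inr ⟨hy, rfl⟩)⟩]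
      · obtain ⟨y, hy⟩ := (h.notMem_iff x).1 hxU
        exact ⟨y, .inl hy⟩
    · rintro ⟨y, hxy⟩ ⟨hxU, hxA⟩
      rcases (hmem x y).1 hxy with h1 | ⟨hx, rfl⟩ | ⟨hy, rfl⟩
      exacts [hNU _ _ h1 hxU, hxA (.inl hx), hxA (.inr ⟨y, hy, rfl⟩)]
  · exact hrob

lemma IsRobust.exists_isPartner {V : Type*} {G : SimpleGraph V}
    (hLF : ∀ v, (G.neighborSet v).Finite) {U : Set V} (hU : IsRobust G U) {x : V} (hx : x ∈ U) :
    ∃ y, IsPartner G U x y := by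
  obtain ⟨ε, hε, m, hm⟩ := hU
  obtain ⟨y, hyU, hxy, hy⟩ := exists_partner hLF (U := U)
    (fun X 𝒞 hb hl => hb.card_le_of_linked (fun X 𝒞 h1 h2 h3 => (hm X 𝒞 h1 h2 h3).1) hl) hx
  exact ⟨y, hyU, hxy, fun X 𝒞 hb _ => hy X 𝒞 hb⟩

/-- Any partial matching with robust complement extends so as to cover the image under a Borel map
of a non-meagre part of a given open set. -/
lemma IsPartialMatching.exists_extension {V : Type*} [TopologicalSpace V] [PolishSpace V]
    [MeasurableSpace V] [BorelSpace V] {G : SimpleGraph V}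
    (hG : MeasurableSet {p : V × V | G.Adj p.1 p.2}) {d : ℕ}
    (hLF : ∀ v, (G.neighborSet v).Finite) (hdeg : ∀ v, (G.neighborSet v).ncard ≤ d)
    {N : Set (V × V)} {U : Set V} (h : IsPartialMatching G N U) (f : V → V)
    {O : Set V} (hO : IsOpen O) (hOne : O.Nonempty) :
    ∃ N' U', N ⊆ N' ∧ IsPartialMatching G N' U' ∧ ¬ IsMeagre (O ∩ f ⁻¹' U'ᶜ) := by
  obtain ⟨w, hw, hwl, hwr⟩ := exists_measurable_near hG hLF hdeg
  obtain ⟨γ, hγ, hγr⟩ := exists_measurable_reachable hG hLF hdeg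
  obtain ⟨r, hr⟩ := h.robust.exists_sdiff hLF
  obtain ⟨C, hC, hCd, hCc⟩ := exists_discrete_cover hLF hw hwl hwr (r + 2)
  let A : TopologicalSpace.countableBasis V × ℕ → Set V := fun k =>
    U ∩ C k.1 ∩ {z | IsPartner G U z (γ k.2 z)}
  by_cases hU : IsMeagre (O ∩ f ⁻¹' Uᶜ)
  swap
  · exact ⟨N, U, subset_rfl, h, hU⟩
  have hex : ∃ k, ¬ IsMeagre (O ∩ f ⁻¹' A k) := by
    by_contra! hcon
    refine not_isMeagre_of_isOpen hO hOne ((hU.union (isMeagre_iUnion hcon)).mono ?_)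
    intro x hx
    by_cases hxU : f x ∈ U
    · right
      obtain ⟨y, hy⟩ := h.robust.exists_isPartner hLF hxU
      obtain ⟨k, hk⟩ := hCc (f x)
      obtain ⟨n, rfl⟩ := (hγr _ _).1 hy.2.1.reachable
      exact mem_iUnion.2 ⟨(k, n), hx, ⟨hxU, hk⟩, hy⟩
    · exact .inl ⟨hx, hxU⟩
  obtain ⟨⟨k, n⟩, hkn⟩ := hex
  have hd : ∀ x ∈ A (k, n), ∀ y ∈ A (k, n), Near G (r + 2) x y → x = y :=
    fun x hx y hy => hCd k x hx.1.2 y hy.1.2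
  have hadj : ∀ x ∈ A (k, n), G.Adj x (γ n x) := fun x hx => hx.2.2.1
  have hN := h.union (A := A (k, n))
    ((h.measurableSet_uncovered.inter (hC k)).inter
      (measurableSet_isPartner hG hγ hγr h.measurableSet_uncovered (hγ n)))
    (fun x hx => hx.1.1) (hγ n) (fun x hx => hx.2.1) hadj
    (fun x hx y hy hxy => hd x hx y hy
      (((hadj x hx).near.trans (hxy ▸ (hadj y hy).symm.near)).mono (by omega)))
    (fun x hx hx' => (hadj x hx).ne (hd x hx _ hx' ((hadj x hx).near.mono (by omega))))
    (hr _ _ (fun x hx => hx.1.1)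
      (fun x hx y hy hxy => hd x hx y hy (hxy.mono (by omega))) fun x hx => hx.2)
  refine ⟨_, _, subset_union_left, hN, fun hm => hkn (hm.mono ?_)⟩
  exact fun x hx => ⟨hx.1, fun hx' => hx'.2 (.inl hx.2)⟩

lemma exists_nat_basis (V : Type*) [TopologicalSpace V] [SecondCountableTopology V] :
    ∃ B : ℕ → Set V, (∀ n, IsOpen (B n)) ∧
      ∀ Q, IsOpen Q → Q.Nonempty → ∃ n, B n ⊆ Q ∧ (B n).Nonempty := by
  have hB := TopologicalSpace.isBasis_countableBasis V
  obtain ⟨B, hBr⟩ := ((TopologicalSpace.countable_countableBasis V).insert ∅).exists_eq_range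
    (insert_nonempty _ _)
  refine ⟨B, fun n => ?_, fun Q hQ hne => ?_⟩
  · rcases hBr.ge (mem_range_self n) with h | h
    · exact h ▸ isOpen_empty
    · exact hB.isOpen h
  · obtain ⟨x, hx⟩ := hne
    obtain ⟨O, hO, hxO, hOQ⟩ := hB.exists_subset_of_mem_open hx hQ
    obtain ⟨n, rfl⟩ := hBr.le (.inr hO)
    exact ⟨n, hOQ, x, hxO⟩

/-- Every Borel graph whose components are infinite, bounded degree,
non-amenable (with uniform constants) vertex-transitive graphs admits a Borel perfect
matching on a Borel comeager invariant set. -/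
theorem stmt_0 {V : Type*} [TopologicalSpace V] [PolishSpace V]
    [MeasurableSpace V] [BorelSpace V]
    (G : SimpleGraph V) (hGmeas : MeasurableSet {p : V × V | G.Adj p.1 p.2})
    (d : ℕ) (δ : ℝ) (hδ : 0 < δ)
    (hLF : ∀ v : V, (G.neighborSet v).Finite)
    (hdeg : ∀ v : V, (G.neighborSet v).ncard ≤ d)
    (hinf : ∀ x : V, {y : V | G.Reachable x y}.Infinite)
    (htrans : ∀ x : V, ∀ u v : {y : V | G.Reachable x y},
      ∃ φ : G.induce {y : V | G.Reachable x y} ≃g G.induce {y : V | G.Reachable x y}, φ u = v)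
    (hexp : ∀ x : V, ∀ F : Set V, F ⊆ {y : V | G.Reachable x y} → F.Finite →
      δ * F.ncard ≤ ((edgesBetween G F ({y : V | G.Reachable x y} \ F)).ncard : ℝ)) :
    ∃ S : Set V, MeasurableSet S ∧ S ∈ residual V ∧ Invariant G S ∧
      ∃ M : Set (V × V), MeasurableSet M ∧ IsPerfectMatchingOn G S M := by
  obtain ⟨γ, hγ, hγr⟩ := exists_measurable_reachable hGmeas hLF hdeg
  obtain ⟨B, hBo, hB⟩ := exists_nat_basis V
  have hstep : ∀ (p : {p : Set (V × V) × Set V // IsPartialMatching G p.1 p.2}) (n : ℕ),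
      ∃ q : {p : Set (V × V) × Set V // IsPartialMatching G p.1 p.2}, p.1.1 ⊆ q.1.1 ∧
        ((B n.unpair.2).Nonempty → ¬ IsMeagre (B n.unpair.2 ∩ γ n.unpair.1 ⁻¹' q.1.2ᶜ)) := by
    rintro ⟨⟨N, U⟩, h⟩ n
    by_cases hne : (B n.unpair.2).Nonempty
    · obtain ⟨N', U', hN, hNU, hm⟩ :=
        h.exists_extension hGmeas hLF hdeg (γ n.unpair.1) (hBo n.unpair.2) hne
      exact ⟨⟨(N', U'), hNU⟩, hN, fun _ => hm⟩
    · exact ⟨⟨(N, U), h⟩, subset_rfl, fun h => absurd h hne⟩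
  choose step hsub hmeagre using hstep
  have hinit : IsPartialMatching G ∅ univ :=
    ⟨.empty, .univ, by simp, by simp, by simp, by simp,
      isRobust_univ G d δ hδ hLF hdeg htrans hexp⟩
  let s : ℕ → {p : Set (V × V) × Set V // IsPartialMatching G p.1 p.2} :=
    fun n => Nat.rec ⟨(∅, univ), hinit⟩ (fun n p => step p n) n
  have hmono : Monotone fun n => (s n).1.1 := monotone_nat_of_le_succ fun n => hsub (s n) n
  let N := ⋃ n, (s n).1.1
  have hN : MeasurableSet N := .iUnion fun n => (s n).2.measurableSet
  have hunique : ∀ x y z, (x, y) ∈ N → (x, z) ∈ N → y = z := by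
    intro x y z hy hz
    obtain ⟨m, hm⟩ := mem_iUnion.1 hy
    obtain ⟨n, hn⟩ := mem_iUnion.1 hz
    exact (s (max m n)).2.unique x y z (hmono (le_max_left m n) hm) (hmono (le_max_right m n) hn)
  let R := ⋃ n, ((s n).1.2)ᶜ
  have hR : MeasurableSet R := .iUnion fun n => (s n).2.measurableSet_uncovered.compl
  have hRN : ∀ x ∈ R, ∃ y, (x, y) ∈ N := by
    intro x hx
    obtain ⟨n, hn⟩ := mem_iUnion.1 hx
    obtain ⟨y, hy⟩ := ((s n).2.notMem_iff x).1 hn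
    exact ⟨y, mem_iUnion.2 ⟨n, hy⟩⟩
  have hres : ∀ j, γ j ⁻¹' R ∈ residual V := by
    intro j
    obtain ⟨Q, hQ, hWQ⟩ := ((hR.preimage (hγ j)).compl).residualEq_isOpen
    rcases Q.eq_empty_or_nonempty with rfl | hne
    · filter_upwards [hWQ.mem_iff] with x hx
      by_contra hxR
      exact hx.1 hxR
    · obtain ⟨b, hbQ, hb⟩ := hB Q hQ hne
      have h := hmeagre (s (Nat.pair j b)) (Nat.pair j b)
      rw [Nat.unpair_pair] at h
      refine absurd ?_ (h hb)
      unfold IsMeagre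
      filter_upwards [hWQ.mem_iff] with x hx hx'
      exact hx.2 (hbQ hx'.1) (mem_iUnion.2 ⟨Nat.pair j b + 1, hx'.2⟩)
  have hS : ∀ x, x ∈ ⋂ j, γ j ⁻¹' R ↔ ∀ y, G.Reachable x y → y ∈ R := by
    intro x
    rw [mem_iInter]
    refine ⟨fun h y hy => ?_, fun h j => h _ ((hγr x _).2 ⟨j, rfl⟩)⟩
    obtain ⟨j, rfl⟩ := (hγr x y).1 hy
    exact h j
  have hinv : Invariant G (⋂ j, γ j ⁻¹' R) := fun x hx y hxy =>
    (hS y).2 fun z hyz => (hS x).1 hx z (hxy.trans hyz)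
  have hmS : MeasurableSet (⋂ j, γ j ⁻¹' R) := .iInter fun j => hR.preimage (hγ j)
  have hadj : ∀ x y, (x, y) ∈ N → G.Adj x y := by
    intro x y hxy
    obtain ⟨n, hn⟩ := mem_iUnion.1 hxy
    exact (s n).2.adj x y hn
  refine ⟨⋂ j, γ j ⁻¹' R, hmS, countable_iInter_mem.2 hres, hinv, N ∩ (⋂ j, γ j ⁻¹' R) ×ˢ
    (⋂ j, γ j ⁻¹' R), hN.inter (hmS.prod hmS), fun p hp => hadj _ _ hp.1, ?_, fun p hp => hp.2, ?_⟩
  · rintro x y ⟨hxy, hx, hy⟩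
    obtain ⟨n, hn⟩ := mem_iUnion.1 hxy
    exact ⟨mem_iUnion.2 ⟨n, (s n).2.symm x y hn⟩, hy, hx⟩
  · intro x hx
    obtain ⟨y, hxy⟩ := hRN x ((hS x).1 hx x .rfl)
    exact ⟨y, ⟨hxy, hx, hinv hx (hadj x y hxy).reachable⟩, fun z hz => hunique x z y hz.1 hxy⟩
end

section
/- Let Γ be a group with a finite symmetric generating set T not containing the identity, and suppose the Cayley graph of Γ with respect to T is a non-amenable graph (i.e., Γ is a finitely generated non-amenable group). Let Γ act freely on a Polish space X by Borel automorphisms, and let G be the Schreier graph of the action: vertices are points of X, with x adjacent to t·x for each t ∈ T (and x ≠ t·x). Then there exists a Borel G-invariant comeager set S ⊆ X and a Borel set M of edges of G such that M is a perfect matching of the induced subgraph of G on S. -/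
open Set

/-- The Cayley graph of `Γ` with respect to `T`: `γ` is adjacent to `t * γ` for `t ∈ T`. -/
def cayleyGraph {Γ : Type*} [Group Γ] (T : Finset Γ) : SimpleGraph Γ :=
  SimpleGraph.fromRel (fun γ γ' => ∃ t ∈ T, γ' = t * γ)

/-- The Schreier graph of an action of `Γ` on `X`: `x` is adjacent to `t • x` for `t ∈ T`. -/
def schreierGraph {Γ X : Type*} [Group Γ] [MulAction Γ X] (T : Finset Γ) : SimpleGraph X :=
  SimpleGraph.fromRel (fun x y => ∃ t ∈ T, y = t • x)

section Boundary

variable {Γ : Type*} [Group Γ] [DecidableEq Γ]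

/-- The number of pairs `(t, x)` with `t ∈ T`, `x ∈ F` and `t * x ∉ F`. -/
def edgeBoundary (T F : Finset Γ) : ℕ := ∑ t ∈ T, (F.filter fun x => t * x ∉ F).card

lemma ncard_edgesBetween_le_s1 {T : Finset Γ} (hsym : ∀ t ∈ T, t⁻¹ ∈ T) (F : Finset Γ) :
    (edgesBetween (cayleyGraph T) (F : Set Γ) (F : Set Γ)ᶜ).ncard ≤ edgeBoundary T F := by
  have hsub : edgesBetween (cayleyGraph T) (F : Set Γ) (F : Set Γ)ᶜ ⊆
      ((T.sigma fun t => F.filter fun x => t * x ∉ F).image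
          fun p => s(p.2, p.1 * p.2) : Finset (Sym2 Γ)) := by
    rintro e ⟨he, a, ha, b, hb, rfl⟩
    rw [SimpleGraph.mem_edgeSet, cayleyGraph, SimpleGraph.fromRel_adj] at he
    obtain ⟨-, ⟨t, ht, rfl⟩ | ⟨t, ht, rfl⟩⟩ := he
    · simp only [Finset.coe_image, Set.mem_image]
      exact ⟨⟨t, a⟩, by simpa using ⟨ht, ha, hb⟩, rfl⟩
    · simp only [Finset.coe_image, Set.mem_image]
      refine ⟨⟨t⁻¹, t * b⟩, ?_, by simp⟩
      simpa using ⟨hsym t ht, ha, hb⟩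
  calc _ ≤ _ := Set.ncard_le_ncard hsub (Finset.finite_toSet _)
    _ ≤ _ := by
      rw [Set.ncard_coe_finset]
      exact Finset.card_image_le.trans (Finset.card_sigma _ _).le

lemma edgeBoundary_inter_add_union_le (T A B : Finset Γ) :
    edgeBoundary T (A ∩ B) + edgeBoundary T (A ∪ B) ≤ edgeBoundary T A + edgeBoundary T B := by
  simp only [edgeBoundary, ← Finset.sum_add_distrib]
  refine Finset.sum_le_sum fun t _ => ?_
  rw [← Finset.card_union_add_card_inter,
    ← Finset.card_union_add_card_inter (A.filter fun x => t * x ∉ A)]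
  refine add_le_add (Finset.card_le_card fun x => ?_) (Finset.card_le_card fun x => ?_) <;>
  · simp only [Finset.mem_union, Finset.mem_inter, Finset.mem_filter]
    tauto

lemma edgeBoundary_image_mul_right (T F : Finset Γ) (g : Γ) :
    edgeBoundary T (F.image (· * g)) = edgeBoundary T F := by
  refine Finset.sum_congr rfl fun t _ => ?_
  rw [Finset.filter_image, Finset.card_image_of_injective _ (mul_left_injective g)]
  congr 1
  refine Finset.filter_congr fun x _ => ?_
  simp [← mul_assoc]

lemma edgeBoundary_subgroup {T F : Finset Γ} (hone : 1 ∈ F)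
    (hdiv : ∀ f ∈ F, ∀ g ∈ F, g * f⁻¹ ∈ F) :
    edgeBoundary T F = (T \ F).card * F.card := by
  have hinv : ∀ f ∈ F, f⁻¹ ∈ F := fun f hf => by simpa using hdiv f hf 1 hone
  rw [edgeBoundary, ← Finset.sum_inter_add_sum_sdiff T F, Finset.sum_eq_zero, zero_add,
    Finset.sum_congr rfl, Finset.sum_const, smul_eq_mul]
  · intro t ht
    rw [Finset.filter_true_of_mem]
    intro x hx htx
    exact (Finset.mem_sdiff.1 ht).2 (by simpa using hdiv x hx _ htx)
  · intro t ht
    rw [Finset.card_eq_zero, Finset.filter_eq_empty_iff]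
    intro x hx htx
    exact htx (by simpa using hdiv _ (hinv x hx) t (Finset.mem_inter.1 ht).2)

/-- In a Cayley graph all of whose finite nonempty vertex sets have nonempty boundary, the
edge-connectivity is at least the degree. -/
lemma card_le_edgeBoundary {T : Finset Γ} (hid : (1 : Γ) ∉ T)
    (hpos : ∀ F : Finset Γ, F.Nonempty → 0 < edgeBoundary T F)
    {F : Finset Γ} (hF : F.Nonempty) : T.card ≤ edgeBoundary T F := by
  obtain ⟨A, hA, hAmin⟩ := (measure (edgeBoundary T)).wf.has_min
    {A : Finset Γ | A.Nonempty} ⟨F, hF⟩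
  obtain ⟨B, ⟨hB, hBA⟩, hBmin⟩ := (measure (Finset.card (α := Γ))).wf.has_min
    {B : Finset Γ | B.Nonempty ∧ edgeBoundary T B = edgeBoundary T A} ⟨A, hA, rfl⟩
  replace hAmin : ∀ C : Finset Γ, C.Nonempty → edgeBoundary T B ≤ edgeBoundary T C :=
    fun C hC => hBA ▸ not_lt.1 (hAmin C hC)
  replace hBmin : ∀ C : Finset Γ, C.Nonempty → edgeBoundary T C = edgeBoundary T B →
      B.card ≤ C.card := fun C hC h => not_lt.1 (hBmin C ⟨hC, h.trans hBA⟩)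
  refine le_trans ?_ (hAmin F hF)
  obtain ⟨b, hb⟩ := hB
  set H := B.image (· * b⁻¹) with hH
  have hone : 1 ∈ H := Finset.mem_image.2 ⟨b, hb, mul_inv_cancel b⟩
  have hHB : edgeBoundary T H = edgeBoundary T B := edgeBoundary_image_mul_right T B b⁻¹
  have hHcard : H.card = B.card := Finset.card_image_of_injective _ (mul_left_injective _)
  have hdiv : ∀ f ∈ H, ∀ g ∈ H, g * f⁻¹ ∈ H := by
    intro f hf g hg
    set K := H.image (· * f⁻¹) with hK
    have hKB : edgeBoundary T K = edgeBoundary T B :=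
      (edgeBoundary_image_mul_right T H f⁻¹).trans hHB
    have hKcard : K.card = H.card := Finset.card_image_of_injective _ (mul_left_injective _)
    have hmem : 1 ∈ H ∩ K :=
      Finset.mem_inter.2 ⟨hone, Finset.mem_image.2 ⟨f, hf, mul_inv_cancel f⟩⟩
    have h1 := hAmin (H ∩ K) ⟨1, hmem⟩
    have h2 := hAmin (H ∪ K) ⟨1, Finset.mem_union_left _ hone⟩
    have h3 := edgeBoundary_inter_add_union_le T H K
    have h4 := hBmin (H ∩ K) ⟨1, hmem⟩ (by omega)
    have h5 : H ∩ K = K :=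
      Finset.eq_of_subset_of_card_le Finset.inter_subset_right (by omega)
    have hgK : g * f⁻¹ ∈ K := Finset.mem_image_of_mem _ hg
    rw [← h5] at hgK
    exact Finset.inter_subset_left hgK
  have hsub := edgeBoundary_subgroup (T := T) hone hdiv
  have hTH : 0 < (T \ H).card := by
    have := hpos H ⟨1, hone⟩
    rw [hsub] at this
    exact pos_of_mul_pos_left this (Nat.zero_le _)
  have hint : (T ∩ H).card + 1 ≤ H.card := by
    rw [← Finset.card_erase_add_one hone]
    refine Nat.add_le_add_right (Finset.card_le_card fun t ht => ?_) 1
    rw [Finset.mem_inter] at ht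
    exact Finset.mem_erase.2 ⟨fun h => hid (h ▸ ht.1), ht.2⟩
  have hsum := Finset.card_sdiff_add_card_inter T H
  rw [← hHB, hsub]
  nlinarith

end Boundary

section Barrier

/-- The labels whose fibres in `Z` are of odd size. -/
def oddClasses {V : Type*} (Z : Finset V) (c : V → ℕ) : Finset ℕ :=
  (Z.image c).filter fun i => Odd (Z.filter fun v => c v = i).card

lemma mem_oddClasses {V : Type*} {Z : Finset V} {c : V → ℕ} {i : ℕ} :
    i ∈ oddClasses Z c ↔ Odd (Z.filter fun v => c v = i).card := by
  rw [oddClasses, Finset.mem_filter, and_iff_right_iff_imp]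
  intro h
  obtain ⟨v, hv⟩ := Finset.card_pos.1 h.pos
  rw [Finset.mem_filter] at hv
  exact Finset.mem_image.2 ⟨v, hv.1, hv.2⟩

variable {Γ : Type*} [Group Γ]

/-- An obstruction to the existence of a perfect matching of the Cayley graph of `Γ` with the
vertices in `Q` removed: removing also `S` leaves the set `Z` isolated and split by `c` into
mutually nonadjacent pieces, more than `S.card` of which have odd size. -/
structure IsBarrier_s1 (T : Finset Γ) (Q : Set Γ) (S Z : Finset Γ) (c : Γ → ℕ) : Prop where
  notMem : ∀ v ∈ Z, v ∉ Q
  nbhd : ∀ v ∈ Z, ∀ t ∈ T, t * v ∈ S ∨ t * v ∈ Q ∨ (t * v ∈ Z ∧ c (t * v) = c v)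
  card_lt : S.card < (oddClasses Z c).card

/-- There is no barrier after removal of `Q`. -/
def BarrierFree (T : Finset Γ) (Q : Set Γ) : Prop :=
  ∀ S Z c, ¬ IsBarrier_s1 T Q S Z c

/-- Right translations are automorphisms of the Cayley graph. -/
lemma BarrierFree.of_translate {T : Finset Γ} {Q : Set Γ} (g : Γ)
    (hQ : BarrierFree T {γ | γ * g ∈ Q}) : BarrierFree T Q := by
  intro S Z c h
  have hmem : ∀ (A : Finset Γ) v, v ∈ A.map (mulRightEmbedding g⁻¹) ↔ v * g ∈ A := by
    intro A v
    simp [← eq_mul_inv_iff_mul_eq]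
  refine hQ (S.map (mulRightEmbedding g⁻¹)) (Z.map (mulRightEmbedding g⁻¹)) (fun v => c (v * g))
    ⟨fun v hv => ?_, fun v hv t ht => ?_, ?_⟩
  · exact h.notMem _ ((hmem Z v).1 hv)
  · rw [hmem, hmem, Set.mem_ofPred_eq, mul_assoc]
    exact h.nbhd _ ((hmem Z v).1 hv) t ht
  · rw [Finset.card_map]
    refine h.card_lt.trans_le (Finset.card_le_card fun i hi => ?_)
    rw [mem_oddClasses] at hi ⊢
    rw [Finset.filter_map, Finset.card_map]
    simpa [Function.comp_def] using hi

variable [DecidableEq Γ]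

/-- Double counting of the edges at `S ∪ R`. -/
lemma card_mul_oddClasses_add_edgeBoundary_le {T : Finset Γ} (hsym : ∀ t ∈ T, t⁻¹ ∈ T)
    (hconn : ∀ F : Finset Γ, F.Nonempty → T.card ≤ edgeBoundary T F)
    {S R Z : Finset Γ} {c : Γ → ℕ}
    (hZ : ∀ v ∈ Z, ∀ t ∈ T, t * v ∈ S ∨ t * v ∈ R ∨ (t * v ∈ Z ∧ c (t * v) = c v)) :
    T.card * (oddClasses Z c).card + edgeBoundary T (S ∪ R ∪ Z) ≤ T.card * (S ∪ R).card := by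
  have h1 : T.card * (oddClasses Z c).card ≤
      ((T ×ˢ (S ∪ R)).filter fun p => p.1 * p.2 ∈ Z).card := by
    calc T.card * (oddClasses Z c).card
        = ∑ i ∈ oddClasses Z c, T.card := by rw [Finset.sum_const, smul_eq_mul, mul_comm]
      _ ≤ ∑ i ∈ oddClasses Z c, edgeBoundary T (Z.filter fun v => c v = i) :=
        Finset.sum_le_sum fun i hi => hconn _ (Finset.card_pos.1 (mem_oddClasses.1 hi).pos)
      _ ≤ ∑ i ∈ oddClasses Z c, (((T ×ˢ (S ∪ R)).filter fun p => p.1 * p.2 ∈ Z).filter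
            fun p => c (p.1 * p.2) = i).card := by
        refine Finset.sum_le_sum fun i _ => ?_
        rw [edgeBoundary, ← Finset.card_sigma]
        refine Finset.card_le_card_of_injOn (fun p => (p.1⁻¹, p.1 * p.2)) ?_ ?_
        · rintro ⟨t, x⟩ hp
          simp only [Finset.coe_sigma, Set.mem_sigma_iff, Finset.mem_coe, Finset.mem_filter] at hp
          obtain ⟨ht, ⟨hx, hc⟩, hn⟩ := hp
          simp only [Finset.coe_filter, Finset.mem_filter, Finset.mem_product, Finset.mem_union,
            Set.mem_ofPred_eq, inv_mul_cancel_left]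
          refine ⟨⟨⟨hsym t ht, ?_⟩, hx⟩, hc⟩
          rcases hZ x hx t ht with h | h | ⟨h, h'⟩
          · exact Or.inl h
          · exact Or.inr h
          · exact absurd ⟨h, h'.trans hc⟩ hn
        · rintro ⟨t, x⟩ - ⟨s, y⟩ - h
          simp only [Prod.mk.injEq, inv_inj] at h
          obtain ⟨rfl, h⟩ := h
          rw [mul_right_inj] at h
          rw [h]
      _ ≤ _ := by
        rw [← Finset.card_biUnion]
        · exact Finset.card_le_card (Finset.biUnion_subset.2 fun i _ => Finset.filter_subset _ _)
        · intro i _ j _ hij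
          rw [Function.onFun, Finset.disjoint_left]
          intro p hp hq
          exact hij ((Finset.mem_filter.1 hp).2.symm.trans (Finset.mem_filter.1 hq).2)
  have h2 : edgeBoundary T (S ∪ R ∪ Z) ≤
      ((T ×ˢ (S ∪ R)).filter fun p => ¬ p.1 * p.2 ∈ Z).card := by
    rw [edgeBoundary, ← Finset.card_sigma]
    refine Finset.card_le_card_of_injOn (fun p => (p.1, p.2)) ?_ ?_
    · rintro ⟨t, x⟩ hp
      simp only [Finset.coe_sigma, Set.mem_sigma_iff, Finset.mem_coe, Finset.mem_filter,
        Finset.mem_union] at hp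
      simp only [Finset.coe_filter, Finset.mem_product, Finset.mem_union, Set.mem_ofPred_eq]
      refine ⟨⟨hp.1, ?_⟩, fun h => hp.2.2 (Or.inr h)⟩
      by_contra hx
      have hxZ : x ∈ Z := by tauto
      have := hZ x hxZ t hp.1
      tauto
    · rintro ⟨t, x⟩ - ⟨s, y⟩ - h
      simp only [Prod.mk.injEq] at h
      rw [h.1, h.2]
  have h3 := Finset.card_filter_add_card_filter_not (s := T ×ˢ (S ∪ R)) (fun p => p.1 * p.2 ∈ Z)
  rw [Finset.card_product] at h3
  omega

lemma barrierFree_empty {T : Finset Γ} (hsym : ∀ t ∈ T, t⁻¹ ∈ T)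
    (hconn : ∀ F : Finset Γ, F.Nonempty → T.card ≤ edgeBoundary T F) (hT : T.Nonempty) :
    BarrierFree T ∅ := by
  intro S Z c h
  have h1 := card_mul_oddClasses_add_edgeBoundary_le hsym hconn (S := S) (R := ∅) (Z := Z) (c := c)
    (by simpa using h.nbhd)
  rw [Finset.union_empty] at h1
  exact absurd (Nat.le_of_mul_le_mul_left ((Nat.le_add_right _ _).trans h1) hT.card_pos)
    (not_le.2 h.card_lt)

/-- If there is a barrier, there is one whose vertex set is connected. -/
lemma exists_isBarrier_connected {T : Finset Γ} (hsym : ∀ t ∈ T, t⁻¹ ∈ T) {Q : Set Γ}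
    (hQ : ¬ BarrierFree T Q) :
    ∃ S Z c, IsBarrier_s1 T Q S Z c ∧ ∀ P : Γ → Prop, (∃ w ∈ S ∪ Z, P w) → (∃ w ∈ S ∪ Z, ¬ P w) →
      ∃ w ∈ S ∪ Z, ∃ t ∈ T, t * w ∈ S ∪ Z ∧ P w ∧ ¬ P (t * w) := by
  classical
  simp only [BarrierFree, not_forall, not_not] at hQ
  obtain ⟨S₀, Z₀, c, h₀⟩ := hQ
  obtain ⟨⟨S, Z⟩, hSZ, hmin⟩ :=
    (measure (fun p : Finset Γ × Finset Γ => p.1.card + p.2.card)).wf.has_min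
    {p | IsBarrier_s1 T Q p.1 p.2 c} ⟨(S₀, Z₀), h₀⟩
  refine ⟨S, Z, c, hSZ, fun P hP hnP => ?_⟩
  by_contra! hcon
  replace hmin : ∀ p : Γ → Prop, IsBarrier_s1 T Q (S.filter p) (Z.filter p) c →
      ∀ w ∈ S ∪ Z, p w := by
    intro p hp w hw
    have h1 := hmin (S.filter p, Z.filter p) hp
    change ¬ (S.filter p).card + (Z.filter p).card < S.card + Z.card at h1
    have h2 := Finset.card_filter_le S p
    have h3 := Finset.card_filter_le Z p
    rcases Finset.mem_union.1 hw with hw | hw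
    · exact Finset.filter_card_eq (by omega) w hw
    · exact Finset.filter_card_eq (by omega) w hw
  have key : ∀ p : Γ → Prop, (∀ w ∈ S ∪ Z, p w → ∀ t ∈ T, t * w ∈ S ∪ Z → p (t * w)) →
      (∃ w ∈ S ∪ Z, ¬ p w) →
      (oddClasses (Z.filter p) c).card ≤ (S.filter p).card := by
    intro p hp ⟨w, hw, hnw⟩
    by_contra! hlt
    refine hnw (hmin p ⟨fun v hv => hSZ.notMem v (Finset.mem_filter.1 hv).1, ?_, hlt⟩ w hw)
    intro v hv t ht
    rw [Finset.mem_filter] at hv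
    have := hp v (Finset.mem_union_right _ hv.1) hv.2 t ht
    have := hSZ.nbhd v hv.1 t ht
    simp only [Finset.mem_union, Finset.mem_filter] at *
    tauto
  have k1 := key P (fun w hw hPw t ht htw => hcon w hw t ht htw hPw) hnP
  have k2 : (oddClasses (Z.filter fun w => ¬ P w) c).card ≤ (S.filter fun w => ¬ P w).card := by
    convert key (fun w => ¬ P w) (fun w hw hPw t ht htw hn => hPw (by
      have := hcon (t * w) htw t⁻¹ (hsym t ht) (by simpa using hw) hn
      simpa using this)) (by simpa using hP)
  have k3 : oddClasses Z c ⊆ oddClasses (Z.filter P) c ∪ oddClasses (Z.filter fun w => ¬ P w) c := by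
    intro i hi
    rw [Finset.mem_union, mem_oddClasses, mem_oddClasses]
    have hsplit : (Z.filter fun v => c v = i).card =
        ((Z.filter P).filter fun v => c v = i).card +
          ((Z.filter fun w => ¬ P w).filter fun v => c v = i).card := by
      rw [← Finset.card_filter_add_card_filter_not (s := Z.filter fun v => c v = i) P]
      congr 2 <;>
      · ext w
        simp only [Finset.mem_filter]
        tauto
    rw [mem_oddClasses, hsplit] at hi
    by_contra! h
    exact Nat.not_odd_iff_even.2 ((Nat.not_odd_iff_even.1 h.1).add (Nat.not_odd_iff_even.1 h.2)) hi
  have k4 := (Finset.card_le_card k3).trans (Finset.card_union_le _ _)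
  have k5 := Finset.card_filter_add_card_filter_not (s := S) P
  have : S.card < (oddClasses Z c).card := hSZ.card_lt
  omega

end Barrier

section Tutte

/-- Tutte's theorem for graphs of even order, in terms of labellings. -/
lemma exists_isPerfectMatching_of_oddClasses {V : Type*} [Fintype V] [DecidableEq V]
    (H : SimpleGraph V) (heven : Even (Fintype.card V))
    (h : ∀ (S : Finset V) (c : V → ℕ), (∀ u v, u ∉ S → v ∉ S → H.Adj u v → c u = c v) →
      (oddClasses Sᶜ c).card ≤ S.card + 1) :
    ∃ M : H.Subgraph, M.IsPerfectMatching := by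
  classical
  rw [SimpleGraph.tutte]
  intro u hu
  rw [SimpleGraph.IsTutteViolator] at hu
  set D := (⊤ : H.Subgraph).deleteVerts u with hD
  have hverts : ∀ v, v ∈ D.verts ↔ v ∉ u := by simp [hD]
  obtain ⟨e⟩ : Nonempty (D.coe.ConnectedComponent ≃ Fin (Nat.card D.coe.ConnectedComponent)) :=
    ⟨Finite.equivFin _⟩
  set L : D.coe.ConnectedComponent → ℕ := fun C => (e C : ℕ) with hL
  have hLinj : Function.Injective L := fun a b hab => e.injective (Fin.ext hab)
  set c : V → ℕ := fun v => if hv : v ∈ D.verts then L (D.coe.connectedComponentMk ⟨v, hv⟩) else 0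
  have hc : ∀ v (hv : v ∈ D.verts), c v = L (D.coe.connectedComponentMk ⟨v, hv⟩) :=
    fun v hv => dif_pos hv
  have h1 := h u.toFinset c fun a b ha hb hab => by
    rw [Set.mem_toFinset, ← hverts] at ha hb
    rw [hc a ha, hc b hb]
    congr 1
    refine SimpleGraph.ConnectedComponent.connectedComponentMk_eq_of_adj ?_
    have hadj : D.Adj a b := by
      rw [hD, SimpleGraph.Subgraph.deleteVerts_adj]
      simpa [hab] using ⟨(hverts a).1 ha, (hverts b).1 hb⟩
    exact hadj
  have h2 : D.coe.oddComponents.ncard ≤ (oddClasses u.toFinsetᶜ c).card := by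
    rw [← Set.ncard_coe_finset]
    refine Set.ncard_le_ncard_of_injOn L (fun C hC => ?_) hLinj.injOn (Finset.finite_toSet _)
    rw [Finset.mem_coe, mem_oddClasses]
    have : ((u.toFinsetᶜ.filter fun v => c v = L C : Finset V) : Set V) =
        Subtype.val '' C.supp := by
      ext v
      simp only [Finset.coe_filter, Finset.mem_compl, Set.mem_toFinset, Set.mem_ofPred_eq,
        Set.mem_image, SimpleGraph.ConnectedComponent.mem_supp_iff, Subtype.exists,
        exists_and_right, exists_eq_right]
      rw [← hverts]
      exact ⟨fun ⟨hv, hvC⟩ => ⟨hv, hLinj ((hc v hv).symm.trans hvC)⟩,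
        fun ⟨hv, hvC⟩ => ⟨hv, (hc v hv).trans (congrArg L hvC)⟩⟩
    rw [← Set.ncard_coe_finset, this, Set.ncard_image_of_injective _ Subtype.val_injective]
    exact hC
  have h3 : Nat.card D.verts + u.ncard = Fintype.card V := by
    have : D.verts = uᶜ := Set.ext hverts
    rw [Nat.card_coe_set_eq, this, add_comm, Set.ncard_add_ncard_compl, Nat.card_eq_fintype_card]
  have h4 := SimpleGraph.odd_ncard_oddComponents D.coe
  rw [← Set.ncard_eq_toFinset_card'] at h1
  rw [Nat.odd_iff, Nat.odd_iff] at h4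
  rw [Nat.even_iff] at heven
  omega

variable {Γ : Type*} [Group Γ] [DecidableEq Γ]

/-- If there is no barrier, every finite set of vertices is covered by a matching. -/
lemma BarrierFree.exists_matching {T : Finset Γ} (hsym : ∀ t ∈ T, t⁻¹ ∈ T) {Q : Set Γ}
    (hQ : BarrierFree T Q) (F : Finset Γ) (hF : ∀ v ∈ F, v ∉ Q) :
    ∃ p : Γ → Γ, ∀ v ∈ F, (∃ t ∈ T, p v = t * v) ∧ p v ∉ Q ∧ p (p v) = v := by
  classical
  set F' : Finset (Option Γ) := F.image some with hF'
  have hmemF' : ∀ v, some v ∈ F' ↔ v ∈ F := by simp [hF']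
  set U₀ : Finset (Option Γ) :=
    F' ∪ (((T ×ˢ F).image fun p => p.1 * p.2).filter fun v => v ∉ Q).image some with hU₀
  have hnone : none ∉ U₀ := by simp [hU₀, hF']
  obtain ⟨U, hU₀U, hUU₀, heven⟩ : ∃ U, U₀ ⊆ U ∧ U ⊆ insert none U₀ ∧ Even U.card := by
    rcases Nat.even_or_odd U₀.card with h | h
    · exact ⟨U₀, subset_rfl, Finset.subset_insert _ _, h⟩
    · exact ⟨insert none U₀, Finset.subset_insert _ _, subset_rfl,
        by rw [Finset.card_insert_of_notMem hnone]; exact h.add_one⟩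
  have hUF : ∀ v ∈ F, some v ∈ U := fun v hv =>
    hU₀U (Finset.mem_union_left _ ((hmemF' v).2 hv))
  have hUN : ∀ v ∈ F, ∀ t ∈ T, t * v ∉ Q → some (t * v) ∈ U := fun v hv t ht h =>
    hU₀U (Finset.mem_union_right _ (Finset.mem_image_of_mem _ (Finset.mem_filter.2
      ⟨Finset.mem_image.2 ⟨(t, v), Finset.mem_product.2 ⟨ht, hv⟩, rfl⟩, h⟩)))
  have hUQ : ∀ v, some v ∈ U → v ∉ Q := by
    intro v hv
    have := hUU₀ hv
    simp only [hU₀, hF', Finset.mem_insert, reduceCtorEq, Finset.mem_union, Finset.mem_image,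
      Option.some.injEq, exists_eq_right, Finset.mem_filter, false_or] at this
    exact this.elim (hF v) And.right
  -- The finite graph: the Cayley graph, with all vertices outside `F` joined to each other.
  let H : SimpleGraph U := SimpleGraph.fromRel fun a b =>
    (a.1 ∉ F' ∧ b.1 ∉ F') ∨ ∃ v, ∃ t ∈ T, a.1 = some v ∧ b.1 = some (t * v)
  have hHF : ∀ a b : U, H.Adj a b → ∀ v ∈ F, a.1 = some v → ∃ t ∈ T, b.1 = some (t * v) := by
    intro a b hab v hv hav
    have hva := (hmemF' v).2 hv
    rw [← hav] at hva
    rw [SimpleGraph.fromRel_adj] at hab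
    obtain ⟨-, (h | ⟨w, t, ht, h1, h2⟩) | (h | ⟨w, t, ht, h1, h2⟩)⟩ := hab
    · exact absurd hva h.1
    · rw [hav, Option.some_inj] at h1
      exact ⟨t, ht, h1 ▸ h2⟩
    · exact absurd hva h.2
    · rw [hav, Option.some_inj] at h2
      exact ⟨t⁻¹, hsym t ht, by simp [h2, h1]⟩
  obtain ⟨M, hM⟩ : ∃ M : H.Subgraph, M.IsPerfectMatching := by
    refine exists_isPerfectMatching_of_oddClasses H (by simpa using heven) fun S c hc => ?_
    set S' : Finset Γ := (S.image Subtype.val).preimage some (Option.some_injective Γ).injOn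
    have hS' : ∀ v (hv : some v ∈ U), v ∈ S' ↔ ⟨some v, hv⟩ ∈ S := by
      intro v hv
      simp [S', hv]
    have hS'card : S'.card ≤ S.card := by
      calc S'.card ≤ (S.image Subtype.val).card :=
            Finset.card_le_card_of_injOn some (fun v hv => Finset.mem_preimage.1 hv)
              (Option.some_injective Γ).injOn
        _ ≤ _ := Finset.card_image_le
    set c' : Γ → ℕ := fun v => if hv : some v ∈ U then c ⟨some v, hv⟩ else 0
    have hc' : ∀ v (hv : some v ∈ U), c' v = c ⟨some v, hv⟩ := fun v hv => dif_pos hv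
    set Z : Finset Γ := F.filter fun v => v ∉ S' ∧
      ∀ w : U, w ∉ S → w.1 ∉ F' → c w ≠ c' v with hZ
    have hbar : (oddClasses Z c').card ≤ S'.card := by
      by_contra! hlt
      refine hQ S' Z c' ⟨fun v hv => hF v (Finset.mem_filter.1 hv).1, fun v hv t ht => ?_, hlt⟩
      obtain ⟨hvF, hvS, hvc⟩ := Finset.mem_filter.1 hv
      by_cases htQ : t * v ∈ Q
      · exact Or.inr (Or.inl htQ)
      have htU := hUN v hvF t ht htQ
      by_cases htS : t * v ∈ S'
      · exact Or.inl htS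
      have hcc : c' (t * v) = c' v := by
        by_cases htv : t * v = v
        · rw [htv]
        rw [hc' _ htU, hc' v (hUF v hvF)]
        refine hc _ _ (by rwa [← hS']) (by rwa [← hS']) ?_
        rw [SimpleGraph.fromRel_adj]
        exact ⟨by simpa using htv, Or.inr (Or.inr ⟨v, t, ht, rfl, rfl⟩)⟩
      refine Or.inr (Or.inr ⟨Finset.mem_filter.2 ⟨?_, htS, ?_⟩, hcc⟩)
      · by_contra htF
        exact hvc ⟨_, htU⟩ (by rwa [← hS']) (by rwa [hmemF']) (by rw [← hcc, hc' _ htU])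
      · rw [hcc]
        exact hvc
    have hsub : ∃ b, oddClasses Sᶜ c ⊆ insert b (oddClasses Z c') := by
      have hcls : ∀ i, (∀ w : U, w ∉ S → w.1 ∉ F' → c w ≠ i) → i ∈ oddClasses Sᶜ c →
          i ∈ oddClasses Z c' := by
        intro i hi hodd
        rw [mem_oddClasses] at hodd ⊢
        convert hodd using 1
        refine Finset.card_bij (fun v hv => ⟨some v, hUF v (Finset.mem_filter.1
          (Finset.mem_filter.1 hv).1).1⟩) (fun v hv => ?_) (fun v _ w _ h => ?_) (fun w hw => ?_)
        · simp only [hZ, Finset.mem_filter] at hv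
          rw [Finset.mem_filter, Finset.mem_compl, ← hS', ← hc']
          exact ⟨hv.1.2.1, hv.2⟩
        · simpa using h
        · rw [Finset.mem_filter, Finset.mem_compl] at hw
          have hwF : w.1 ∈ F' := by
            by_contra hwF
            exact hi w hw.1 hwF hw.2
          obtain ⟨v, hv, hvw⟩ := Finset.mem_image.1 hwF
          have hwe : (⟨some v, hUF v hv⟩ : U) = w := Subtype.ext hvw
          have hcv : c' v = i := by rw [hc' v (hUF v hv), hwe, hw.2]
          refine ⟨v, ?_, hwe⟩
          rw [Finset.mem_filter, hZ, Finset.mem_filter, hS' v (hUF v hv), hwe, hcv]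
          exact ⟨⟨hv, hw.1, hi⟩, rfl⟩
      by_cases hb : ∃ w : U, w ∉ S ∧ w.1 ∉ F'
      · obtain ⟨w, hwS, hwF⟩ := hb
        refine ⟨c w, fun i hi => ?_⟩
        by_cases hiw : i = c w
        · exact Finset.mem_insert.2 (Or.inl hiw)
        refine Finset.mem_insert_of_mem (hcls i (fun w' hw'S hw'F h => hiw ?_) hi)
        rw [← h]
        by_cases hww : w' = w
        · rw [hww]
        · refine hc _ _ hw'S hwS ?_
          rw [SimpleGraph.fromRel_adj]
          exact ⟨hww, Or.inl (Or.inl ⟨hw'F, hwF⟩)⟩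
      · push Not at hb
        exact ⟨0, fun i hi => Finset.mem_insert_of_mem
          (hcls i (fun w hwS hwF => absurd (hb w hwS) hwF) hi)⟩
    obtain ⟨b, hb⟩ := hsub
    have := (Finset.card_le_card hb).trans (Finset.card_insert_le _ _)
    omega
  rw [SimpleGraph.Subgraph.isPerfectMatching_iff] at hM
  choose q hq hq' using hM
  have hqq : ∀ a, q (q a) = a := fun a => (hq' _ _ (hq a).symm).symm
  refine ⟨fun v => if hv : some v ∈ U then (q ⟨some v, hv⟩).1.getD 1 else 1, fun v hv => ?_⟩
  obtain ⟨t, ht, htv⟩ := hHF _ _ (hq ⟨some v, hUF v hv⟩).adj_sub v hv rfl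
  have htU : some (t * v) ∈ U := htv ▸ (q ⟨some v, hUF v hv⟩).2
  have hqe : q ⟨some v, hUF v hv⟩ = ⟨some (t * v), htU⟩ := Subtype.ext htv
  have hqe' : q ⟨some (t * v), htU⟩ = ⟨some v, hUF v hv⟩ := by rw [← hqe, hqq]
  have hpv : (if hv : some v ∈ U then (q ⟨some v, hv⟩).1.getD 1 else 1) = t * v := by
    rw [dif_pos (hUF v hv), hqe, Option.getD_some]
  simp only [hpv]
  refine ⟨⟨t, ht, rfl⟩, hUQ _ htU, ?_⟩
  rw [dif_pos htU, hqe', Option.getD_some]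

/-- In the absence of barriers, every vertex can be matched without creating a barrier. -/
lemma BarrierFree.exists_insert {T : Finset Γ} (hsym : ∀ t ∈ T, t⁻¹ ∈ T) (hid : (1 : Γ) ∉ T)
    {Q : Set Γ} (hQ : BarrierFree T Q) {x : Γ} (hx : x ∉ Q) :
    ∃ t ∈ T, t * x ∉ Q ∧ BarrierFree T (Q ∪ {x, t * x}) := by
  classical
  by_contra! hcon
  have hbar : ∀ t : Γ, ∃ S Z c, t ∈ T → t * x ∉ Q → IsBarrier_s1 T (Q ∪ {x, t * x}) S Z c := by
    intro t
    by_cases h : t ∈ T ∧ t * x ∉ Q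
    · have := hcon t h.1 h.2
      simp only [BarrierFree, not_forall, not_not] at this
      obtain ⟨S, Z, c, h⟩ := this
      exact ⟨S, Z, c, fun _ _ => h⟩
    · exact ⟨∅, ∅, fun _ => 0, fun h1 h2 => absurd ⟨h1, h2⟩ h⟩
  choose S Z c hbar using hbar
  obtain ⟨p, hp⟩ := hQ.exists_matching hsym
    (insert x ((T.biUnion Z).filter fun v => v ∉ Q)) (by
      intro v hv
      rcases Finset.mem_insert.1 hv with rfl | hv
      · exact hx
      · exact (Finset.mem_filter.1 hv).2)
  obtain ⟨⟨t, ht, hpx⟩, hpQ, hppx⟩ := hp x (Finset.mem_insert_self _ _)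
  have hB := hbar t ht (hpx ▸ hpQ)
  have hpZ : ∀ v ∈ Z t, (∃ s ∈ T, p v = s * v) ∧ p v ∉ Q ∧ p (p v) = v := fun v hv =>
    hp v (Finset.mem_insert_of_mem (Finset.mem_filter.2
      ⟨Finset.mem_biUnion.2 ⟨t, ht, hv⟩, fun h => hB.notMem v hv (Or.inl h)⟩))
  have hstep : ∀ v ∈ Z t, p v ∈ S t ∨ (p v ∈ Z t ∧ c t (p v) = c t v) := by
    intro v hv
    obtain ⟨⟨s, hs, hsv⟩, hvQ, hppv⟩ := hpZ v hv
    have hnm := hB.notMem v hv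
    rcases hB.nbhd v hv s hs with h | h | h
    · exact Or.inl (hsv ▸ h)
    · rw [← hsv] at h
      rcases h with h | h | h
      · exact absurd h hvQ
      · rw [h] at hppv
        exact absurd (Or.inr (Or.inr (hppv ▸ hpx))) hnm
      · rw [h, ← hpx, hppx] at hppv
        exact absurd (Or.inr (Or.inl hppv.symm)) hnm
    · exact Or.inr (hsv ▸ h)
  have hex : ∀ i ∈ oddClasses (Z t) (c t), ∃ v ∈ Z t, c t v = i ∧ p v ∈ S t := by
    intro i hi
    by_contra! hno
    rw [mem_oddClasses] at hi
    refine Nat.not_even_iff_odd.2 hi ?_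
    have hsum := Finset.sum_involution (s := (Z t).filter fun v => c t v = i)
      (f := fun _ => (1 : ZMod 2)) (fun v _ => p v) (fun _ _ => by decide) (fun v hv _ h => ?_)
      (fun v hv => ?_) (fun v hv => (hpZ v (Finset.mem_filter.1 hv).1).2.2)
    · rw [Finset.sum_const, nsmul_one] at hsum
      exact (ZMod.natCast_eq_zero_iff_even).1 hsum
    · obtain ⟨⟨s, hs, hsv⟩, -⟩ := hpZ v (Finset.mem_filter.1 hv).1
      rw [h] at hsv
      exact hid (mul_eq_right.1 hsv.symm ▸ hs)
    · rw [Finset.mem_filter] at hv ⊢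
      have := (hstep v hv.1).resolve_left (hno v hv.1 hv.2)
      exact ⟨this.1, this.2.trans hv.2⟩
  choose! r hrZ hrc hrS using hex
  refine absurd hB.card_lt (not_lt.2 (Finset.card_le_card_of_injOn (fun i => p (r i)) hrS ?_))
  intro i hi j hj hij
  rw [← hrc i hi, ← hrc j hj, ← (hpZ _ (hrZ i hi)).2.2, ← (hpZ _ (hrZ j hj)).2.2]
  exact congrArg (fun y => c t (p y)) hij

end Tutte

section Step

open scoped Pointwise

variable {Γ : Type*} [Group Γ] [DecidableEq Γ]

/-- The ball of radius `k` about the identity in the Cayley graph. -/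
def cayleyBall (T : Finset Γ) (k : ℕ) : Finset Γ := insert 1 T ^ k

lemma cayleyBall_mono (T : Finset Γ) : Monotone (cayleyBall T) :=
  fun _ _ h => Finset.pow_subset_pow_right (Finset.mem_insert_self 1 T) h

lemma mul_mem_cayleyBall {T : Finset Γ} {t w : Γ} {k : ℕ} (ht : t ∈ T) (hw : w ∈ cayleyBall T k) :
    t * w ∈ cayleyBall T (k + 1) := by
  rw [cayleyBall, pow_succ']
  exact Finset.mul_mem_mul (Finset.mem_insert_of_mem ht) hw

lemma one_mem_cayleyBall (T : Finset Γ) (k : ℕ) : 1 ∈ cayleyBall T k :=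
  cayleyBall_mono T (Nat.zero_le k) (by simp [cayleyBall])

/-- A connected set `W` meeting a ball and reaching far outside of it has many elements near it. -/
lemma lt_card_filter_cayleyBall {T W : Finset Γ}
    (hW : ∀ P : Γ → Prop, (∃ w ∈ W, P w) → (∃ w ∈ W, ¬ P w) →
      ∃ w ∈ W, ∃ t ∈ T, t * w ∈ W ∧ P w ∧ ¬ P (t * w))
    {g : Γ} {r : ℕ} (hnear : ∃ w ∈ W, w * g⁻¹ ∈ cayleyBall T r) (k : ℕ)
    (hfar : ∃ w ∈ W, w * g⁻¹ ∉ cayleyBall T (k + r)) :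
    k < (W.filter fun w => w * g⁻¹ ∈ cayleyBall T (k + r)).card := by
  induction k with
  | zero =>
    obtain ⟨w, hw, hwg⟩ := hnear
    exact Finset.card_pos.2 ⟨w, Finset.mem_filter.2 ⟨hw, by simpa using hwg⟩⟩
  | succ k ih =>
    have hmono : cayleyBall T (k + r) ⊆ cayleyBall T (k + 1 + r) := cayleyBall_mono T (by omega)
    obtain ⟨w, hw, hwf⟩ := hfar
    specialize ih ⟨w, hw, fun h => hwf (hmono h)⟩
    obtain ⟨v, hv⟩ := Finset.card_pos.1 (Nat.zero_lt_of_lt ih)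
    rw [Finset.mem_filter] at hv
    obtain ⟨u, hu, t, ht, htu, h1, h2⟩ := hW (fun w => w * g⁻¹ ∈ cayleyBall T (k + r))
      ⟨v, hv⟩ ⟨w, hw, fun h => hwf (hmono h)⟩
    refine lt_of_le_of_lt (Nat.succ_le_of_lt ih) (Finset.card_lt_card
      (Finset.ssubset_iff_subset_ne.2 ⟨fun x hx => ?_, fun h => h2 ?_⟩))
    · rw [Finset.mem_filter] at hx ⊢
      exact ⟨hx.1, hmono hx.2⟩
    · have hmem : t * u ∈ W.filter fun w => w * g⁻¹ ∈ cayleyBall T (k + 1 + r) := by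
        refine Finset.mem_filter.2 ⟨htu, ?_⟩
        rw [mul_assoc, show k + 1 + r = k + r + 1 by omega]
        exact mul_mem_cayleyBall ht h1
      rw [← h] at hmem
      exact (Finset.mem_filter.1 hmem).2

/-- Few elements of a sparse set are close to a given connected set. -/
lemma card_mul_le_card_of_sparse {T W : Finset Γ}
    (hW : ∀ P : Γ → Prop, (∃ w ∈ W, P w) → (∃ w ∈ W, ¬ P w) →
      ∃ w ∈ W, ∃ t ∈ T, t * w ∈ W ∧ P w ∧ ¬ P (t * w))
    {P : Finset Γ} {r k : ℕ} (hP : 1 < P.card)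
    (hsparse : ∀ g ∈ P, ∀ g' ∈ P, g ≠ g' →
      ∀ w, w * g⁻¹ ∈ cayleyBall T (k + r) → w * g'⁻¹ ∉ cayleyBall T (k + r))
    (hnear : ∀ g ∈ P, ∃ w ∈ W, w * g⁻¹ ∈ cayleyBall T r) :
    P.card * k ≤ W.card := by
  calc P.card * k = ∑ g ∈ P, k := by rw [Finset.sum_const, smul_eq_mul]
    _ ≤ ∑ g ∈ P, (W.filter fun w => w * g⁻¹ ∈ cayleyBall T (k + r)).card := by
      refine Finset.sum_le_sum fun g hg => ?_
      obtain ⟨g', hg', hne⟩ := Finset.exists_mem_ne hP g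
      obtain ⟨w, hw, hwg'⟩ := hnear g' hg'
      exact (lt_card_filter_cayleyBall hW (hnear g hg) k ⟨w, hw, hsparse g' hg' g hg hne w
        (cayleyBall_mono T (by omega) hwg')⟩).le
    _ = (P.biUnion fun g => W.filter fun w => w * g⁻¹ ∈ cayleyBall T (k + r)).card := by
      rw [Finset.card_biUnion]
      intro g hg g' hg' hne
      rw [Function.onFun, Finset.disjoint_left]
      intro w hw hw'
      exact hsparse g hg g' hg' hne w (Finset.mem_filter.1 hw).2 (Finset.mem_filter.1 hw').2
    _ ≤ W.card := Finset.card_le_card (Finset.biUnion_subset.2 fun _ _ => Finset.filter_subset _ _)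

/-- The endpoints of the edges from `g ∈ a j` to `s j g * g`, for `j < n`. -/
def matchedVerts (a : ℕ → Set Γ) (s : ℕ → Γ → Γ) (n : ℕ) : Set Γ :=
  {h | ∃ j < n, ∃ g ∈ a j, h = g ∨ h = s j g * g}

/-- If each of the sparse edges of the `n`-th stage can be removed individually without creating a
barrier, they can be removed simultaneously. -/
lemma barrierFree_matchedVerts_succ {T : Finset Γ} (hsym : ∀ t ∈ T, t⁻¹ ∈ T)
    (hconn : ∀ F : Finset Γ, F.Nonempty → T.card ≤ edgeBoundary T F) (hT : T.Nonempty)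
    {δ : ℝ} (hδ : 0 < δ) (hexp : ∀ F : Finset Γ, δ * F.card ≤ edgeBoundary T F)
    {k : ℕ → ℕ} (hk : Monotone k) (hkpos : ∀ j, 0 < k j)
    (hksum : ∀ n, T.card * ∑ j ∈ Finset.range n, (2 : ℝ) / k j ≤ δ)
    {a : ℕ → Set Γ} {s : ℕ → Γ → Γ} (hs : ∀ j, ∀ g ∈ a j, s j g ∈ T)
    (hsparse : ∀ j, ∀ g ∈ a j, ∀ g' ∈ a j, g ≠ g' →
      ∀ w, w * g⁻¹ ∈ cayleyBall T (k j + 2) → w * g'⁻¹ ∉ cayleyBall T (k j + 2))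
    {n : ℕ} (hn : BarrierFree T (matchedVerts a s n))
    (hn' : ∀ g ∈ a n, BarrierFree T (matchedVerts a s n ∪ {g, s n g * g})) :
    BarrierFree T (matchedVerts a s (n + 1)) := by
  classical
  by_contra hbar
  obtain ⟨S, Z, c, hB, hW⟩ := exists_isBarrier_connected hsym hbar
  set W := S ∪ Z with hWdef
  have hnear : ∀ j, ∀ g ∈ a j, ∀ v ∈ Z, ∀ t ∈ T, (t * v = g ∨ t * v = s j g * g) →
      ∃ w ∈ W, w * g⁻¹ ∈ cayleyBall T 2 := by
    intro j g hg v hv t ht h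
    refine ⟨v, Finset.mem_union_right _ hv, ?_⟩
    have h1 : t⁻¹ ∈ cayleyBall T 1 := by
      simpa using mul_mem_cayleyBall (k := 0) (hsym t ht) (one_mem_cayleyBall T 0)
    have h2 : s j g ∈ cayleyBall T 1 := by
      simpa using mul_mem_cayleyBall (k := 0) (hs j g hg) (one_mem_cayleyBall T 0)
    rcases h with h | h
    · rw [eq_inv_mul_of_mul_eq h, mul_inv_cancel_right]
      exact cayleyBall_mono T one_le_two h1
    · rw [eq_inv_mul_of_mul_eq h, ← mul_assoc, mul_inv_cancel_right]
      exact mul_mem_cayleyBall (hsym t ht) h2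
  have hmono : matchedVerts a s n ⊆ matchedVerts a s (n + 1) :=
    fun h ⟨j, hj, hh⟩ => ⟨j, hj.trans (Nat.lt_succ_self n), hh⟩
  have hlast : ∀ h ∈ matchedVerts a s (n + 1), h ∈ matchedVerts a s n ∨
      ∃ g ∈ a n, h = g ∨ h = s n g * g := by
    rintro h ⟨j, hj, hh⟩
    rcases (Nat.lt_succ_iff_lt_or_eq.1 hj) with hj | rfl
    · exact Or.inl ⟨j, hj, hh⟩
    · exact Or.inr hh
  have htwo : ∃ g ∈ a n, ∃ g' ∈ a n, g ≠ g' ∧ (∃ w ∈ W, w * g⁻¹ ∈ cayleyBall T 2) ∧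
      ∃ w ∈ W, w * g'⁻¹ ∈ cayleyBall T 2 := by
    by_contra! hone
    by_cases htouch : ∃ g ∈ a n, ∃ v ∈ Z, ∃ t ∈ T, t * v = g ∨ t * v = s n g * g
    · obtain ⟨g, hg, v, hv, t, ht, htv⟩ := htouch
      refine hn' g hg S Z c ⟨fun u hu => ?_, fun u hu r hr => ?_, hB.card_lt⟩
      · rintro (h | h)
        · exact hB.notMem u hu (hmono h)
        · refine hB.notMem u hu ⟨n, Nat.lt_succ_self n, g, hg, h⟩
      · rcases hB.nbhd u hu r hr with h | h | h
        · exact Or.inl h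
        · refine Or.inr (Or.inl ?_)
          rcases hlast _ h with h | ⟨g', hg', h⟩
          · exact Or.inl h
          · obtain ⟨w, hw, hwg'⟩ := hnear n g' hg' u hu r hr h
            have : g = g' := by
              by_contra hne
              exact hone g hg g' hg' hne (hnear n g hg v hv t ht htv) w hw hwg'
            subst this
            exact Or.inr h
        · exact Or.inr (Or.inr h)
    · push Not at htouch
      refine hn S Z c ⟨fun u hu h => hB.notMem u hu (hmono h), fun u hu r hr => ?_, hB.card_lt⟩
      rcases hB.nbhd u hu r hr with h | h | h
      · exact Or.inl h
      · refine Or.inr (Or.inl ((hlast _ h).resolve_right ?_))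
        rintro ⟨g, hg, h⟩
        have := htouch g hg u hu r hr
        tauto
      · exact Or.inr (Or.inr h)
  have hkW : k n ≤ W.card := by
    obtain ⟨g, hg, g', hg', hne, hw, hw'⟩ := htwo
    have hcard : ({g, g'} : Finset Γ).card = 2 := Finset.card_pair hne
    have hmem : ∀ x ∈ ({g, g'} : Finset Γ), x ∈ a n ∧ ∃ w ∈ W, w * x⁻¹ ∈ cayleyBall T 2 := by
      intro x hx
      rw [Finset.mem_insert, Finset.mem_singleton] at hx
      rcases hx with rfl | rfl
      exacts [⟨hg, hw⟩, ⟨hg', hw'⟩]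
    have := card_mul_le_card_of_sparse hW (k := k n) (hcard.symm ▸ one_lt_two)
      (fun x hx y hy => hsparse n x (hmem x hx).1 y (hmem y hy).1) (fun x hx => (hmem x hx).2)
    rw [hcard] at this
    omega
  have hfew : ∀ j ≤ n, ∀ P : Finset Γ, (∀ g ∈ P, g ∈ a j) →
      (∀ g ∈ P, ∃ w ∈ W, w * g⁻¹ ∈ cayleyBall T 2) → P.card * k j ≤ W.card := by
    intro j hj P hPa hPn
    rcases Nat.lt_or_ge 1 P.card with h | h
    · exact card_mul_le_card_of_sparse hW h
        (fun x hx y hy => hsparse j x (hPa x hx) y (hPa y hy)) hPn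
    · calc P.card * k j ≤ 1 * k j := Nat.mul_le_mul_right _ h
        _ ≤ W.card := by rw [one_mul]; exact (hk hj).trans hkW
  set N : Finset Γ := (T ×ˢ Z).image fun p => p.1 * p.2
  let R : ℕ → Finset Γ := fun j => N.filter fun h => ∃ g ∈ a j, h = g ∨ h = s j g * g
  have hR : ∀ j ≤ n, ((R j).card : ℝ) ≤ W.card * (2 / k j) := by
    intro j hj
    have hch : ∀ h ∈ R j, ∃ g ∈ a j, h = g ∨ h = s j g * g := fun h hh => (Finset.mem_filter.1 hh).2
    choose! f hfa hf using hch
    have h1 : ((R j).image f).card * k j ≤ W.card := by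
      refine hfew j hj _ (fun g hg => ?_) (fun g hg => ?_)
      · obtain ⟨h, hh, rfl⟩ := Finset.mem_image.1 hg
        exact hfa h hh
      · obtain ⟨h, hh, rfl⟩ := Finset.mem_image.1 hg
        obtain ⟨⟨t, v⟩, htv, hm⟩ := Finset.mem_image.1 (Finset.mem_filter.1 hh).1
        rw [Finset.mem_product] at htv
        refine hnear j (f h) (hfa h hh) v htv.2 t htv.1 ?_
        have := hf h hh
        rwa [← hm] at this ⊢
    have h2 : (R j).card ≤ 2 * ((R j).image f).card := by
      calc (R j).card ≤ ((R j).image f ∪ ((R j).image f).image fun g => s j g * g).card := by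
            refine Finset.card_le_card fun h hh => ?_
            rw [Finset.mem_union]
            have hfh := Finset.mem_image_of_mem f hh
            rcases hf h hh with h1 | h1
            · left; rwa [← h1] at hfh
            · right; rw [h1]; exact Finset.mem_image_of_mem (fun g => s j g * g) hfh
        _ ≤ _ := Finset.card_union_le _ _
        _ ≤ _ := by
          have := Finset.card_image_le (s := (R j).image f) (f := fun g => s j g * g)
          omega
    have hkj : (0 : ℝ) < k j := by exact_mod_cast hkpos j
    rw [mul_div_assoc', le_div_iff₀ hkj]
    have h3 : (R j).card * k j ≤ W.card * 2 := by nlinarith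
    exact_mod_cast h3
  have hdc := card_mul_oddClasses_add_edgeBoundary_le hsym hconn (S := S) (Z := Z) (c := c)
    (R := (Finset.range (n + 1)).biUnion R) (by
      intro v hv t ht
      rcases hB.nbhd v hv t ht with h | ⟨j, hj, h⟩ | h
      · exact Or.inl h
      · exact Or.inr (Or.inl (Finset.mem_biUnion.2 ⟨j, Finset.mem_range.2 hj, Finset.mem_filter.2
          ⟨Finset.mem_image.2 ⟨(t, v), Finset.mem_product.2 ⟨ht, hv⟩, rfl⟩, h⟩⟩))
      · exact Or.inr (Or.inr h))
  have hRsum : (((Finset.range (n + 1)).biUnion R).card : ℝ) ≤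
      W.card * ∑ j ∈ Finset.range (n + 1), (2 : ℝ) / k j := by
    calc (((Finset.range (n + 1)).biUnion R).card : ℝ)
        ≤ ∑ j ∈ Finset.range (n + 1), ((R j).card : ℝ) := by exact_mod_cast Finset.card_biUnion_le
      _ ≤ _ := by
        rw [Finset.mul_sum]
        exact Finset.sum_le_sum fun j hj => hR j (Nat.lt_succ_iff.1 (Finset.mem_range.1 hj))
  set R' := (Finset.range (n + 1)).biUnion R
  have hu : ((S ∪ R').card : ℝ) ≤ S.card + R'.card := by exact_mod_cast Finset.card_union_le _ _
  have hWle : (W.card : ℝ) ≤ (S ∪ R' ∪ Z).card := by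
    refine Nat.cast_le.2 (Finset.card_le_card fun w hw => ?_)
    rw [Finset.mem_union] at hw ⊢
    exact hw.imp_left (Finset.mem_union_left _)
  have hdc' : (T.card : ℝ) * (oddClasses Z c).card + edgeBoundary T (S ∪ R' ∪ Z) ≤
      T.card * (S ∪ R').card := by exact_mod_cast hdc
  have hlt : (S.card : ℝ) + 1 ≤ (oddClasses Z c).card := by exact_mod_cast hB.card_lt
  have hTpos : (0 : ℝ) < T.card := by exact_mod_cast hT.card_pos
  have e1 := hexp (S ∪ R' ∪ Z)
  have e2 := mul_le_mul_of_nonneg_left hWle hδ.le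
  have e3 := mul_le_mul_of_nonneg_left hRsum hTpos.le
  have e4 := mul_le_mul_of_nonneg_left (hksum (n + 1)) (Nat.cast_nonneg (α := ℝ) W.card)
  have e5 := mul_le_mul_of_nonneg_left hu hTpos.le
  have e6 := mul_le_mul_of_nonneg_left hlt hTpos.le
  linarith

end Step

section Generic

lemma countable_of_closure_eq_top {Γ : Type*} [Group Γ] {T : Finset Γ}
    (hgen : Subgroup.closure (T : Set Γ) = ⊤) : Countable Γ := by
  have hfg : Group.FG Γ := ⟨⟨T, hgen⟩⟩
  obtain ⟨S, hS, f, hf⟩ := Group.fg_iff_exists_freeGroup_hom_surjective_finite.1 hfg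
  exact hf.countable

lemma isBarrier_iff {Γ : Type*} [Group Γ] {T : Finset Γ} {Q : Set Γ} {S Z : Finset Γ}
    {c : Γ → ℕ} : IsBarrier_s1 T Q S Z c ↔ (∀ v ∈ Z, v ∉ Q) ∧
      (∀ v ∈ Z, ∀ t ∈ T, t * v ∈ S ∨ t * v ∈ Q ∨ (t * v ∈ Z ∧ c (t * v) = c v)) ∧
      S.card < (oddClasses Z c).card :=
  ⟨fun h => ⟨h.notMem, h.nbhd, h.card_lt⟩, fun h => ⟨h.1, h.2.1, h.2.2⟩⟩

lemma IsBarrier_s1.congr {Γ : Type*} [Group Γ] {T : Finset Γ} {Q : Set Γ} {S Z : Finset Γ}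
    {c d : Γ → ℕ} (hB : IsBarrier_s1 T Q S Z c) (hcd : ∀ v ∈ Z, c v = d v) :
    IsBarrier_s1 T Q S Z d := by
  refine ⟨hB.notMem, fun v hv t ht => ?_, ?_⟩
  · rcases hB.nbhd v hv t ht with h | h | ⟨h, h'⟩
    · exact .inl h
    · exact .inr (.inl h)
    · exact .inr (.inr ⟨h, by rw [← hcd _ h, h', hcd v hv]⟩)
  · have : oddClasses Z d = oddClasses Z c := by
      ext i
      rw [mem_oddClasses, mem_oddClasses, Finset.filter_congr fun v hv => by rw [← hcd v hv]]
    rw [this]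
    exact hB.card_lt

lemma measurableSet_barrierFree {Γ X : Type*} [Group Γ] [Countable Γ] [MeasurableSpace X]
    (T : Finset Γ) {f : X → Set Γ} (hf : ∀ γ, MeasurableSet {x | γ ∈ f x}) :
    MeasurableSet {x | BarrierFree T (f x)} := by
  classical
  have heq : {x | BarrierFree T (f x)} = {x | ∀ (S Z : Finset Γ) (c : Z → ℕ),
      ¬ IsBarrier_s1 T (f x) S Z fun v => if h : v ∈ Z then c ⟨v, h⟩ else 0} := by
    ext x
    refine ⟨fun h S Z c => h S Z _, fun h S Z c hB => h S Z (fun v => c v) (hB.congr ?_)⟩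
    intro v hv
    simp [hv]
  have hmem : ∀ γ, Measurable fun x => γ ∈ f x := fun γ => measurableSet_setOfPred.1 (hf γ)
  rw [heq]
  refine measurableSet_setOfPred.2 (Measurable.forall fun S => Measurable.forall fun Z =>
    Measurable.forall fun c => Measurable.not ?_)
  simp only [isBarrier_iff]
  refine Measurable.and (Measurable.forall fun v => measurable_const.imp (hmem v).not) ?_
  refine Measurable.and (Measurable.forall fun v => measurable_const.imp <|
    Measurable.forall fun t => measurable_const.imp ?_) measurable_const
  exact measurable_const.or ((hmem _).or measurable_const)

variable {Γ X : Type*} [Group Γ] [MulAction Γ X] [TopologicalSpace X]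

/-- The nonidentity elements of `D` move every point of `A` out of `A`. -/
def IsSparse (D : Finset Γ) (A : Set X) : Prop :=
  ∀ x ∈ A, ∀ γ ∈ D, γ ≠ 1 → γ • x ∉ A

variable [MeasurableSpace X] [BorelSpace X]

/-- Countably many sparse Borel sets cover the space. -/
lemma exists_isSparse_cover [SecondCountableTopology X] [T1Space X]
    (hBorel : ∀ γ : Γ, Measurable fun x : X => γ • x)
    (hfree : ∀ γ : Γ, γ ≠ 1 → ∀ x : X, γ • x ≠ x) (D : Finset Γ) :
    ∃ C : TopologicalSpace.countableBasis X → Set X,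
      (∀ i, MeasurableSet (C i) ∧ IsSparse D (C i)) ∧ ⋃ i, C i = univ := by
  refine ⟨fun U => U ∩ ⋂ γ ∈ D, {x | γ ≠ 1 → γ • x ∉ (U : Set X)}, fun U => ⟨?_, ?_⟩, ?_⟩
  · have hU : MeasurableSet (U : Set X) :=
      (TopologicalSpace.isOpen_of_mem_countableBasis U.2).measurableSet
    refine hU.inter (D.measurableSet_biInter fun γ _ => ?_)
    exact measurableSet_setOfPred.2
      (measurable_const.imp (measurableSet_setOfPred.1 (hBorel γ hU)).not)
  · rintro x ⟨-, hx⟩ γ hγ h1 ⟨h, -⟩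
    exact mem_iInter₂.1 hx γ hγ h1 h
  · refine eq_univ_of_forall fun x => ?_
    have hopen : IsOpen ((fun γ : Γ => γ • x) '' ((D : Set Γ) \ {1}))ᶜ :=
      ((D.finite_toSet.subset sdiff_subset).image _).isClosed.isOpen_compl
    obtain ⟨U, hU, hxU, hsub⟩ :=
      (TopologicalSpace.isBasis_countableBasis X).exists_subset_of_mem_open
        (show x ∈ ((fun γ : Γ => γ • x) '' ((D : Set Γ) \ {1}))ᶜ by
          rintro ⟨γ, hγ, h⟩
          exact hfree γ hγ.2 x h) hopen
    refine mem_iUnion.2 ⟨⟨U, hU⟩, hxU, mem_iInter₂.2 fun γ hγ h1 h => hsub h ⟨γ, ⟨hγ, h1⟩, rfl⟩⟩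

lemma exists_isSparse_not_isMeagre [SecondCountableTopology X] [T1Space X] [BaireSpace X]
    (hBorel : ∀ γ : Γ, Measurable fun x : X => γ • x)
    (hfree : ∀ γ : Γ, γ ≠ 1 → ∀ x : X, γ • x ≠ x) (D : Finset Γ)
    (γ : Γ) {U : Set X} (hU : IsOpen U) (hne : U.Nonempty) :
    ∃ A : Set X, MeasurableSet A ∧ IsSparse D A ∧ ¬ IsMeagre (U ∩ {x | γ • x ∈ A}) := by
  obtain ⟨C, hC, hcov⟩ := exists_isSparse_cover hBorel hfree D
  by_contra! h
  refine not_isMeagre_of_isOpen hU hne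
    ((isMeagre_iUnion fun i => h (C i) (hC i).1 (hC i).2).mono fun x hx => ?_)
  obtain ⟨i, hi⟩ := mem_iUnion.1 (hcov.symm ▸ mem_univ (γ • x) : γ • x ∈ ⋃ i, C i)
  exact mem_iUnion.2 ⟨i, hx, hi⟩

/-- There is a sequence of sparse Borel sets which generically meets every orbit everywhere. -/
lemma exists_isSparse_seq [Countable Γ] [SecondCountableTopology X] [T1Space X] [BaireSpace X]
    (hBorel : ∀ γ : Γ, Measurable fun x : X => γ • x)
    (hfree : ∀ γ : Γ, γ ≠ 1 → ∀ x : X, γ • x ≠ x) (D : ℕ → Finset Γ) :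
    ∃ A : ℕ → Set X, (∀ n, MeasurableSet (A n)) ∧ (∀ n, IsSparse (D n) (A n)) ∧
      {x | ∀ γ : Γ, ∃ n, γ • x ∈ A n} ∈ residual X := by
  obtain ⟨code⟩ := nonempty_encodable (Γ × TopologicalSpace.countableBasis X)
  have hex : ∀ n, ∃ A : Set X, MeasurableSet A ∧ IsSparse (D n) A ∧
      ∀ p ∈ Encodable.decode (α := Γ × TopologicalSpace.countableBasis X) n,
        ¬ IsMeagre ((p.2 : Set X) ∩ {x | p.1 • x ∈ A}) := by
    intro n
    rcases Encodable.decode (α := Γ × TopologicalSpace.countableBasis X) n with _ | p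
    · exact ⟨∅, .empty, fun x hx => hx.elim, fun p hp => by simp at hp⟩
    · obtain ⟨A, h1, h2, h3⟩ := exists_isSparse_not_isMeagre hBorel hfree (D n) p.1
        (TopologicalSpace.isOpen_of_mem_countableBasis p.2.2)
        (TopologicalSpace.nonempty_of_mem_countableBasis p.2.2)
      exact ⟨A, h1, h2, fun q hq => by obtain rfl := Option.mem_some_iff.1 hq; exact h3⟩
  choose A hA hsp hnm using hex
  refine ⟨A, hA, hsp, ?_⟩
  have hγ : ∀ γ : Γ, {x | ∃ n, γ • x ∈ A n} ∈ residual X := by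
    intro γ
    set B : Set X := {x | ∃ n, γ • x ∈ A n}ᶜ with hBdef
    have hB : MeasurableSet B := by
      refine (measurableSet_setOfPred.2 (Measurable.exists fun n => ?_)).compl
      exact measurableSet_setOfPred.1 (hBorel γ (hA n))
    obtain ⟨u, hu, hBu⟩ := hB.residualEq_isOpen
    have hmeagre : IsMeagre (symmDiff B u) := by
      refine Filter.mem_of_superset (Filter.eventuallyEq_set.1 hBu) fun x hx => ?_
      have hx' : x ∈ B ↔ x ∈ u := hx
      simp [hx']
    rcases u.eq_empty_or_nonempty with rfl | ⟨x, hx⟩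
    · have : IsMeagre B := hmeagre.mono fun x hx => .inl ⟨hx, notMem_empty x⟩
      simpa [IsMeagre, hBdef] using this
    · obtain ⟨U, hU, -, hsub⟩ :=
        (TopologicalSpace.isBasis_countableBasis X).exists_subset_of_mem_open hx hu
      refine absurd (hmeagre.mono ?_)
        (hnm (Encodable.encode (γ, (⟨U, hU⟩ : TopologicalSpace.countableBasis X))) (γ, ⟨U, hU⟩)
          (Encodable.encodek _))
      rintro y ⟨hyU, hyA⟩
      exact .inr ⟨hsub hyU, fun hyB => hyB ⟨_, hyA⟩⟩
  simpa only [ofPred_forall] using countable_iInter_mem.2 hγ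

end Generic

section Construction

open scoped Pointwise

variable {Γ X : Type*} [Group Γ] [MulAction Γ X]

/-- The points `x` of `A` for which `{x, t • x}` is disjoint from `R` and can be removed in
addition to `R` without creating a barrier. -/
def removablePts (T : Finset Γ) (R A : Set X) (t : Γ) : Set X :=
  {x | x ∈ A ∧ x ∉ R ∧ t • x ∉ R ∧ BarrierFree T ({γ | γ • x ∈ R} ∪ {1, t})}

/-- The points `x` of `A` for which `t` is the first generator, in the order given by `e`, such
that `{x, t • x}` can be removed. -/
def firstRemovablePts (T : Finset Γ) (e : Γ → ℕ) (R A : Set X) (t : Γ) : Set X :=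
  {x | x ∈ removablePts T R A t ∧ ∀ s ∈ T, e s < e t → x ∉ removablePts T R A s}

/-- The vertices matched before the `n`-th stage. -/
def stageVerts (T : Finset Γ) (e : Γ → ℕ) (A : ℕ → Set X) : ℕ → Set X
  | 0 => ∅
  | n + 1 => stageVerts T e A n ∪ {x | ∃ t ∈ T,
      x ∈ firstRemovablePts T e (stageVerts T e A n) (A n) t ∨
      t⁻¹ • x ∈ firstRemovablePts T e (stageVerts T e A n) (A n) t}

/-- The points `x` for which the edge `{x, t • x}` is put into the matching at the `n`-th stage. -/
def stagePts (T : Finset Γ) (e : Γ → ℕ) (A : ℕ → Set X) (n : ℕ) (t : Γ) : Set X :=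
  firstRemovablePts T e (stageVerts T e A n) (A n) t

variable {T : Finset Γ} {e : Γ → ℕ} {A : ℕ → Set X}

lemma mem_stageVerts_succ {n : ℕ} {x : X} : x ∈ stageVerts T e A (n + 1) ↔
    x ∈ stageVerts T e A n ∨ ∃ t ∈ T, x ∈ stagePts T e A n t ∨ t⁻¹ • x ∈ stagePts T e A n t :=
  Iff.rfl

lemma mem_stageVerts {n : ℕ} {x : X} : x ∈ stageVerts T e A n ↔
    ∃ j < n, ∃ t ∈ T, x ∈ stagePts T e A j t ∨ t⁻¹ • x ∈ stagePts T e A j t := by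
  induction n with
  | zero => simp [stageVerts]
  | succ n ih => rw [mem_stageVerts_succ, ih, Nat.exists_lt_succ_right]

lemma stageVerts_mono : Monotone (stageVerts T e A) :=
  monotone_nat_of_le_succ fun _ _ hx => mem_stageVerts_succ.2 (.inl hx)

lemma stagePts_unique (he : Function.Injective e) {n : ℕ} {s t : Γ} (hs : s ∈ T) (ht : t ∈ T)
    {x : X} (hxs : x ∈ stagePts T e A n s) (hxt : x ∈ stagePts T e A n t) : s = t := by
  rcases lt_trichotomy (e s) (e t) with h | h | h
  · exact absurd hxs.1 (hxt.2 s hs h)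
  · exact he h
  · exact absurd hxt.1 (hxs.2 t ht h)

lemma exists_mem_stagePts {n : ℕ} {t : Γ} (ht : t ∈ T) {x : X}
    (hx : x ∈ removablePts T (stageVerts T e A n) (A n) t) : ∃ s ∈ T, x ∈ stagePts T e A n s := by
  classical
  obtain ⟨s, hs, hmin⟩ := Finset.exists_min_image
    (T.filter fun s => x ∈ removablePts T (stageVerts T e A n) (A n) s) e
    ⟨t, Finset.mem_filter.2 ⟨ht, hx⟩⟩
  rw [Finset.mem_filter] at hs
  exact ⟨s, hs.1, hs.2, fun r hr hlt hxr =>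
    hlt.not_ge (hmin r (Finset.mem_filter.2 ⟨hr, hxr⟩))⟩

lemma measurableSet_stageVerts [Countable Γ] [MeasurableSpace X]
    (hBorel : ∀ γ : Γ, Measurable fun x : X => γ • x) (hA : ∀ n, MeasurableSet (A n)) (n : ℕ) :
    MeasurableSet (stageVerts T e A n) ∧ ∀ t, MeasurableSet (stagePts T e A n t) := by
  have hstep : ∀ n, MeasurableSet (stageVerts T e A n) →
      ∀ t, MeasurableSet (stagePts T e A n t) := by
    intro n hR t
    have hrem : ∀ t, MeasurableSet (removablePts T (stageVerts T e A n) (A n) t) := by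
      intro t
      refine (hA n).inter (hR.compl.inter ((hBorel t hR).compl.inter
        (measurableSet_barrierFree T fun γ => ?_)))
      exact (hBorel γ hR).union (.const (γ ∈ ({1, t} : Set Γ)))
    refine (hrem t).inter (measurableSet_setOfPred.2 ?_)
    exact Measurable.forall fun s => measurable_const.imp (measurable_const.imp
      (measurableSet_setOfPred.1 (hrem s)).not)
  induction n with
  | zero => exact ⟨.empty, hstep 0 .empty⟩
  | succ n ih =>
    suffices h : MeasurableSet (stageVerts T e A (n + 1)) from ⟨h, hstep _ h⟩
    refine ih.1.union (measurableSet_setOfPred.2 (Measurable.exists fun t =>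
      measurable_const.and ?_))
    exact (measurableSet_setOfPred.1 (ih.2 t)).or
      (measurableSet_setOfPred.1 (hBorel t⁻¹ (ih.2 t)))

/-- The edges put into the matching at the `n`-th stage. -/
def StageAdj (T : Finset Γ) (e : Γ → ℕ) (A : ℕ → Set X) (n : ℕ) (x y : X) : Prop :=
  ∃ t ∈ T, (x ∈ stagePts T e A n t ∧ y = t • x) ∨ (y ∈ stagePts T e A n t ∧ x = t • y)

lemma StageAdj.symm {n : ℕ} {x y : X} (h : StageAdj T e A n x y) : StageAdj T e A n y x := by
  obtain ⟨t, ht, h⟩ := h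
  exact ⟨t, ht, h.symm⟩

lemma StageAdj.mem {n : ℕ} {x y : X} (h : StageAdj T e A n x y) :
    x ∈ stageVerts T e A (n + 1) ∧ x ∉ stageVerts T e A n := by
  rw [mem_stageVerts_succ]
  obtain ⟨t, ht, ⟨h, -⟩ | ⟨h, rfl⟩⟩ := h
  · exact ⟨.inr ⟨t, ht, .inl h⟩, h.1.2.1⟩
  · exact ⟨.inr ⟨t, ht, .inr (by rwa [inv_smul_smul])⟩, h.1.2.2.1⟩

lemma exists_stageAdj {n : ℕ} {x : X} (hx : x ∈ stageVerts T e A n) :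
    ∃ j y, StageAdj T e A j x y := by
  obtain ⟨j, -, t, ht, h | h⟩ := mem_stageVerts.1 hx
  · exact ⟨j, t • x, t, ht, .inl ⟨h, rfl⟩⟩
  · exact ⟨j, t⁻¹ • x, t, ht, .inr ⟨h, (smul_inv_smul t x).symm⟩⟩

lemma measurableSet_stageAdj [Countable Γ] [TopologicalSpace X] [SecondCountableTopology X]
    [T2Space X] [MeasurableSpace X] [BorelSpace X]
    (hBorel : ∀ γ : Γ, Measurable fun x : X => γ • x) (hA : ∀ n, MeasurableSet (A n)) (n : ℕ) :
    MeasurableSet {p : X × X | StageAdj T e A n p.1 p.2} := by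
  have hB := (measurableSet_stageVerts (T := T) (e := e) hBorel hA n).2
  refine measurableSet_setOfPred.2 (Measurable.exists fun t => measurable_const.and ?_)
  refine Measurable.or (Measurable.and ?_ ?_) (Measurable.and ?_ ?_) <;>
    refine measurableSet_setOfPred.1 ?_
  · exact measurable_fst (hB t)
  · exact measurableSet_eq_fun measurable_snd ((hBorel t).comp measurable_fst)
  · exact measurable_snd (hB t)
  · exact measurableSet_eq_fun measurable_fst ((hBorel t).comp measurable_snd)

variable [DecidableEq Γ]

lemma barrierFree_stageVerts (hsym : ∀ t ∈ T, t⁻¹ ∈ T)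
    (hconn : ∀ F : Finset Γ, F.Nonempty → T.card ≤ edgeBoundary T F) (hT : T.Nonempty)
    {δ : ℝ} (hδ : 0 < δ) (hexp : ∀ F : Finset Γ, δ * F.card ≤ edgeBoundary T F)
    {k : ℕ → ℕ} (hk : Monotone k) (hkpos : ∀ j, 0 < k j)
    (hksum : ∀ n, T.card * ∑ j ∈ Finset.range n, (2 : ℝ) / k j ≤ δ)
    (hA : ∀ n, IsSparse ((cayleyBall T (k n + 2))⁻¹ * cayleyBall T (k n + 2)) (A n))
    (he : Function.Injective e) (x : X) (n : ℕ) :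
    BarrierFree T {γ | γ • x ∈ stageVerts T e A n} := by
  classical
  set a : ℕ → Set Γ := fun j => {γ | ∃ t ∈ T, γ • x ∈ stagePts T e A j t} with ha
  have hlabel : ∀ j γ, ∃ t, γ ∈ a j → t ∈ T ∧ γ • x ∈ stagePts T e A j t := by
    intro j γ
    by_cases h : γ ∈ a j
    · obtain ⟨t, ht⟩ := h
      exact ⟨t, fun _ => ht⟩
    · exact ⟨1, fun h' => absurd h' h⟩
  choose s hs using hlabel
  have heq : ∀ n, {γ | γ • x ∈ stageVerts T e A n} = matchedVerts a s n := by
    intro n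
    ext γ
    rw [Set.mem_ofPred_eq, mem_stageVerts]
    constructor
    · rintro ⟨j, hj, t, ht, h | h⟩
      · exact ⟨j, hj, γ, ⟨t, ht, h⟩, .inl rfl⟩
      · rw [smul_smul] at h
        have hmem : t⁻¹ * γ ∈ a j := ⟨t, ht, h⟩
        refine ⟨j, hj, t⁻¹ * γ, hmem, .inr ?_⟩
        rw [stagePts_unique he (hs j _ hmem).1 ht (hs j _ hmem).2 h, mul_inv_cancel_left]
    · rintro ⟨j, hj, g, hg, rfl | rfl⟩
      · exact ⟨j, hj, s j γ, (hs j γ hg).1, .inl (hs j γ hg).2⟩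
      · refine ⟨j, hj, s j g, (hs j g hg).1, .inr ?_⟩
        rw [smul_smul, inv_mul_cancel_left]
        exact (hs j g hg).2
  rw [heq]
  induction n with
  | zero =>
    rw [show matchedVerts a s 0 = ∅ by simp [matchedVerts]]
    exact barrierFree_empty hsym hconn hT
  | succ n ih =>
    refine barrierFree_matchedVerts_succ hsym hconn hT hδ hexp hk hkpos hksum
      (fun j g hg => (hs j g hg).1) ?_ ih ?_
    · intro j g hg g' hg' hne w hw hw'
      refine hA j (g • x) (hs j g hg).2.1.1 (g' * g⁻¹) ?_ ?_ ?_
      · rw [show g' * g⁻¹ = (w * g'⁻¹)⁻¹ * (w * g⁻¹) by group]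
        exact Finset.mul_mem_mul (Finset.inv_mem_inv hw') hw
      · rwa [Ne, mul_inv_eq_one, eq_comm]
      · rw [smul_smul, inv_mul_cancel_right]
        exact (hs j g' hg').2.1.1
    · intro g hg
      refine BarrierFree.of_translate g ?_
      convert (hs n g hg).2.1.2.2.2 using 1
      ext γ
      rw [← heq]
      simp [smul_smul]

lemma mem_stageVerts_succ_of_mem (hsym : ∀ t ∈ T, t⁻¹ ∈ T) (hid : (1 : Γ) ∉ T) {n : ℕ} {x : X}
    (hfree : BarrierFree T {γ | γ • x ∈ stageVerts T e A n}) (hx : x ∈ A n) :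
    x ∈ stageVerts T e A (n + 1) := by
  rw [mem_stageVerts_succ]
  by_cases hxR : x ∈ stageVerts T e A n
  · exact .inl hxR
  obtain ⟨t, ht, htR, hbf⟩ := hfree.exists_insert hsym hid (x := 1) (by simpa using hxR)
  rw [mul_one] at htR hbf
  obtain ⟨s, hs, hxs⟩ := exists_mem_stagePts ht (show x ∈ removablePts T _ _ t from
    ⟨hx, hxR, htR, hbf⟩)
  exact .inr ⟨s, hs, .inl hxs⟩

lemma StageAdj.unique (hid : (1 : Γ) ∉ T) (he : Function.Injective e) {k : ℕ → ℕ}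
    (hA : ∀ n, IsSparse ((cayleyBall T (k n + 2))⁻¹ * cayleyBall T (k n + 2)) (A n))
    {m n : ℕ} {x y z : X} (hy : StageAdj T e A m x y) (hz : StageAdj T e A n x z) : y = z := by
  have hmn : ∀ {m n y z}, StageAdj T e A m x y → StageAdj T e A n x z → n ≤ m :=
    fun hy hz => not_lt.1 fun h => hz.mem.2 (stageVerts_mono h hy.mem.1)
  obtain rfl := le_antisymm (hmn hz hy) (hmn hy hz)
  have hball : ∀ t ∈ T, t ∈ cayleyBall T (k m + 2) := fun t ht => by
    simpa using mul_mem_cayleyBall ht (one_mem_cayleyBall T (k m + 1))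
  have hsep : ∀ {u v : X} {s t : Γ}, s ∈ T → t ∈ T → u ∈ stagePts T e A m s →
      v ∈ stagePts T e A m t → ∀ r ∈ cayleyBall T (k m + 2), ∀ r' ∈ cayleyBall T (k m + 2),
      r' • v = r • u → r'⁻¹ * r = 1 := by
    intro u v s t hs ht hu hv r hr r' hr' h
    by_contra hne
    refine hA m u hu.1.1 (r'⁻¹ * r) (Finset.mul_mem_mul (Finset.inv_mem_inv hr') hr) hne ?_
    rw [mul_smul, ← h, inv_smul_smul]
    exact hv.1.1
  obtain ⟨s, hs, ⟨hu, rfl⟩ | ⟨hu, rfl⟩⟩ := hy <;> obtain ⟨t, ht, ⟨hv, rfl⟩ | ⟨hv, hvx⟩⟩ := hz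
  · rw [stagePts_unique he hs ht hu hv]
  · have := hsep hs ht hu hv 1 (one_mem_cayleyBall T _) t (hball t ht) (by rw [one_smul, hvx])
    rw [mul_one, inv_eq_one] at this
    exact absurd (this ▸ ht) hid
  · have := hsep ht hs hv hu 1 (one_mem_cayleyBall T _) s (hball s hs) (by rw [one_smul])
    rw [mul_one, inv_eq_one] at this
    exact absurd (this ▸ hs) hid
  · have := hsep hs ht hu hv s (hball s hs) t (hball t ht) hvx.symm
    rw [inv_mul_eq_one] at this
    subst this
    exact smul_left_cancel t hvx

end Construction

lemma exists_radii {δ : ℝ} (hδ : 0 < δ) (d : ℕ) : ∃ k : ℕ → ℕ, Monotone k ∧ (∀ j, 0 < k j) ∧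
    ∀ n, d * ∑ j ∈ Finset.range n, (2 : ℝ) / k j ≤ δ := by
  obtain ⟨K, hK⟩ := exists_nat_gt (4 * d / δ)
  have hK0 : (0 : ℝ) < K := lt_of_le_of_lt (by positivity) hK
  refine ⟨fun j => K * 2 ^ j, fun i j hij => by dsimp only; gcongr; norm_num,
    fun j => Nat.mul_pos (by exact_mod_cast hK0) (by positivity), fun n => ?_⟩
  calc d * ∑ j ∈ Finset.range n, (2 : ℝ) / ((K * 2 ^ j : ℕ) : ℝ)
      = 2 * d / K * ∑ j ∈ Finset.range n, (1 / (2 : ℝ)) ^ j := by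
        rw [Finset.mul_sum, Finset.mul_sum]
        refine Finset.sum_congr rfl fun j _ => ?_
        push_cast
        rw [div_pow, one_pow]
        field_simp
    _ ≤ 2 * d / K * 2 := by gcongr; exact sum_geometric_two_le n
    _ = 4 * d / K := by ring
    _ ≤ δ := by
        rw [div_lt_iff₀ hδ] at hK
        rw [div_le_iff₀ hK0]
        linarith

/-- Every Schreier graph of a free Borel action of a finitely generated
non-amenable group admits a Borel perfect matching on a Borel comeager invariant set. -/
theorem stmt_1 {Γ X : Type*} [Group Γ] [MulAction Γ X]
    [TopologicalSpace X] [PolishSpace X] [MeasurableSpace X] [BorelSpace X]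
    (T : Finset Γ)
    (hsym : ∀ t ∈ T, t⁻¹ ∈ T) (hid : (1 : Γ) ∉ T)
    (hgen : Subgroup.closure (T : Set Γ) = ⊤)
    (hnonamenable : ∃ δ : ℝ, 0 < δ ∧ ∀ F : Set Γ, F.Finite →
      δ * F.ncard ≤ ((edgesBetween (cayleyGraph T) F Fᶜ).ncard : ℝ))
    (hBorel : ∀ γ : Γ, Measurable (fun x : X => γ • x))
    (hfree : ∀ γ : Γ, γ ≠ 1 → ∀ x : X, γ • x ≠ x) :
    ∃ S : Set X, MeasurableSet S ∧ S ∈ residual X ∧ Invariant (schreierGraph (X := X) T) S ∧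
      ∃ M : Set (X × X), MeasurableSet M ∧ IsPerfectMatchingOn (schreierGraph (X := X) T) S M := by
  classical
  obtain ⟨δ, hδ, hnon⟩ := hnonamenable
  have hexp : ∀ F : Finset Γ, δ * F.card ≤ edgeBoundary T F := fun F => by
    refine le_trans ?_ (Nat.cast_le.2 (ncard_edgesBetween_le_s1 hsym F))
    simpa using hnon F F.finite_toSet
  have hpos : ∀ F : Finset Γ, F.Nonempty → 0 < edgeBoundary T F := fun F hF => by
    have h : (0 : ℝ) < F.card := Nat.cast_pos.2 hF.card_pos
    exact_mod_cast (mul_pos hδ h).trans_le (hexp F)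
  have hT : T.Nonempty := by
    rw [Finset.nonempty_iff_ne_empty]
    rintro rfl
    simpa [edgeBoundary] using hpos {1} (Finset.singleton_nonempty 1)
  have hconn : ∀ F : Finset Γ, F.Nonempty → T.card ≤ edgeBoundary T F :=
    fun F hF => card_le_edgeBoundary hid hpos hF
  have hcount : Countable Γ := countable_of_closure_eq_top hgen
  obtain ⟨e, he⟩ := exists_injective_nat Γ
  obtain ⟨k, hk, hkpos, hksum⟩ := exists_radii hδ T.card
  open scoped Pointwise in
  obtain ⟨A, hA, hsparse, hres⟩ := exists_isSparse_seq (X := X) hBorel hfree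
    fun n => (cayleyBall T (k n + 2))⁻¹ * cayleyBall T (k n + 2)
  have hbf := barrierFree_stageVerts hsym hconn hT hδ hexp hk hkpos hksum hsparse he
  set S : Set X := {x | ∀ γ : Γ, ∃ n, γ • x ∈ A n} with hS
  have hsmul : ∀ {x : X} (t : Γ), x ∈ S → t • x ∈ S := fun {x} t hx γ => by
    rw [smul_smul]
    exact hx (γ * t)
  have hSm : MeasurableSet S := measurableSet_setOfPred.2 (Measurable.forall fun γ =>
    Measurable.exists fun n => measurableSet_setOfPred.1 (hBorel γ (hA n)))
  have hadj : ∀ {n : ℕ} {x y : X}, StageAdj T e A n x y → ∃ t ∈ T, y = t • x := by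
    rintro n x y ⟨t, ht, ⟨-, h⟩ | ⟨-, rfl⟩⟩
    · exact ⟨t, ht, h⟩
    · exact ⟨t⁻¹, hsym t ht, (inv_smul_smul t y).symm⟩
  refine ⟨S, hSm, hres, fun x hx y hxy => ?_,
    {p | p.1 ∈ S ∧ ∃ n, StageAdj T e A n p.1 p.2}, ?_, ?_, ?_, ?_, ?_⟩
  · obtain ⟨p⟩ := hxy
    induction p with
    | nil => exact hx
    | cons h _ ih =>
      refine ih ?_
      rw [schreierGraph, SimpleGraph.fromRel_adj] at h
      obtain ⟨-, ⟨t, -, rfl⟩ | ⟨t, -, rfl⟩⟩ := h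
      · exact hsmul t hx
      · simpa using hsmul t⁻¹ hx
  · refine (measurable_fst hSm).inter (measurableSet_setOfPred.2 (Measurable.exists fun n => ?_))
    exact measurableSet_setOfPred.1 (measurableSet_stageAdj hBorel hA n)
  · rintro ⟨x, y⟩ ⟨-, n, h⟩
    obtain ⟨t, ht, rfl : y = t • x⟩ := hadj h
    rw [schreierGraph, SimpleGraph.fromRel_adj]
    exact ⟨(hfree t (ne_of_mem_of_not_mem ht hid) x).symm, .inl ⟨t, ht, rfl⟩⟩
  · rintro x y ⟨hx, n, h⟩
    obtain ⟨t, -, rfl : y = t • x⟩ := hadj h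
    exact ⟨hsmul t hx, n, h.symm⟩
  · rintro ⟨x, y⟩ ⟨hx, n, h⟩
    obtain ⟨t, -, rfl : y = t • x⟩ := hadj h
    exact ⟨hx, hsmul t hx⟩
  · intro x hx
    obtain ⟨n, hn⟩ := hx 1
    rw [one_smul] at hn
    obtain ⟨j, y, hy⟩ := exists_stageAdj (mem_stageVerts_succ_of_mem hsym hid (hbf x n) hn)
    exact ⟨y, ⟨hx, j, hy⟩, fun z ⟨_, i, hz⟩ => hz.unique hid he hsparse hy⟩
end
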